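/- arXiv:1710.08257 — 10 statements merged into one kernel-verified Lean document; each statement's English description precedes it below -/
import Mathlib

section
/- Let T ∈ (0,1] and let w : [0,T] × ℝ² → ℂ be measurable such that the function s ↦ (∫_{ℝ²} (1+‖ξ‖²)^{-1/2} |w(s,ξ)|² dξ)^{1/2} is integrable on [0,T]. For t ∈ [0,T] and ξ ∈ ℝ² with ξ ≠ 0, define v_t(ξ) = ∫₀^t (sin((t-s)‖ξ‖)/‖ξ‖) · w(s,ξ) ds. Then there exists a constant C > 0, independent of T and w, such that for every t ∈ [0,T], ∫_{ℝ²} (1+‖ξ‖²)^{1/2} |v_t(ξ)|² dξ ≤ C · ( ∫₀^T ( ∫_{ℝ²} (1+‖ξ‖²)^{-1/2} |w(s,ξ)|² dξ )^{1/2} ds )². -/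
open MeasureTheory Set

/-- `v_t(ξ) = ∫₀^t (sin((t−s)‖ξ‖)/‖ξ‖) w(s,ξ) ds`, the Fourier transform in space of the
wave-kernel space-time convolution `G ∗ w`. -/
noncomputable def waveConv (w : ℝ → EuclideanSpace ℝ (Fin 2) → ℂ)
    (t : ℝ) (ξ : EuclideanSpace ℝ (Fin 2)) : ℂ :=
  ∫ s in (0:ℝ)..t, (Real.sin ((t - s) * ‖ξ‖) / ‖ξ‖) • w s ξ

open scoped ENNReal

/-- Cauchy–Schwarz for the Lebesgue integral of `ℝ≥0∞`-valued functions. -/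
theorem lintegral_mul_le_sqrt_mul_sqrt {α : Type*} [MeasurableSpace α] {μ : Measure α}
    {f g : α → ℝ≥0∞} (hf : AEMeasurable f μ) (hg : AEMeasurable g μ) :
    ∫⁻ x, f x * g x ∂μ ≤
      (∫⁻ x, f x ^ 2 ∂μ) ^ ((1:ℝ)/2) * (∫⁻ x, g x ^ 2 ∂μ) ^ ((1:ℝ)/2) := by
  have h := ENNReal.lintegral_mul_le_Lp_mul_Lq μ Real.HolderConjugate.two_two hf hg
  simpa only [Pi.mul_apply, ENNReal.rpow_two] using h

/-- Minkowski's integral inequality with exponent two. -/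
theorem lintegral_lintegral_sq_le {α β : Type*} [MeasurableSpace α] [MeasurableSpace β]
    {μ : Measure α} {ν : Measure β} [SFinite μ] [SFinite ν] {f : α → β → ℝ≥0∞}
    (hf : Measurable (Function.uncurry f)) :
    ∫⁻ y, (∫⁻ x, f x y ∂μ) ^ 2 ∂ν ≤ (∫⁻ x, (∫⁻ y, f x y ^ 2 ∂ν) ^ ((1:ℝ)/2) ∂μ) ^ 2 := by
  have hfx (x : α) : Measurable (f x) := hf.of_uncurry_left
  have hfy (y : β) : Measurable (fun x ↦ f x y) := hf.of_uncurry_right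
  have hN : Measurable (fun x ↦ (∫⁻ y, f x y ^ 2 ∂ν) ^ ((1:ℝ)/2)) :=
    (Measurable.lintegral_prod_right (hf.pow_const 2)).pow_const _
  calc ∫⁻ y, (∫⁻ x, f x y ∂μ) ^ 2 ∂ν
      = ∫⁻ y, ∫⁻ p, f p.1 y * f p.2 y ∂(μ.prod μ) ∂ν := by
        refine lintegral_congr fun y ↦ ?_
        rw [sq, lintegral_prod_mul (hfy y).aemeasurable (hfy y).aemeasurable]
    _ = ∫⁻ p, ∫⁻ y, f p.1 y * f p.2 y ∂ν ∂(μ.prod μ) := by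
        refine lintegral_lintegral_swap (Measurable.aemeasurable ?_)
        exact (hf.comp (measurable_snd.fst.prodMk measurable_fst)).mul
          (hf.comp (measurable_snd.snd.prodMk measurable_fst))
    _ ≤ ∫⁻ p, (∫⁻ y, f p.1 y ^ 2 ∂ν) ^ ((1:ℝ)/2) *
          (∫⁻ y, f p.2 y ^ 2 ∂ν) ^ ((1:ℝ)/2) ∂(μ.prod μ) :=
        lintegral_mono fun p ↦
          lintegral_mul_le_sqrt_mul_sqrt (hfx p.1).aemeasurable (hfx p.2).aemeasurable
    _ = _ := by rw [sq, lintegral_prod_mul hN.aemeasurable hN.aemeasurable]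

theorem abs_sin_mul_div_le {τ x : ℝ} (hτ : |τ| ≤ 1) :
    |Real.sin (τ * x) / x| ≤ √2 * (√(1 + x ^ 2))⁻¹ := by
  rcases eq_or_ne x 0 with rfl | hx
  · simp
  rw [← Real.sqrt_inv, ← Real.sqrt_mul zero_le_two]
  refine Real.abs_le_sqrt ?_
  have hx2 : 0 < x ^ 2 := by positivity
  rw [div_pow, ← div_eq_mul_inv, div_le_div_iff₀ hx2 (by positivity)]
  have h1 : Real.sin (τ * x) ^ 2 ≤ x ^ 2 := by
    refine sq_le_sq.2 (Real.abs_sin_le_abs.trans ?_)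
    rw [abs_mul]
    exact mul_le_of_le_one_left (abs_nonneg x) hτ
  nlinarith [Real.sin_sq_le_one (τ * x)]

/-- Pointwise bound of the weighted wave convolution by the time integral of the weighted source. -/
theorem rpow_mul_enorm_waveConv_le (w : ℝ → EuclideanSpace ℝ (Fin 2) → ℂ) {t T : ℝ}
    (ht : t ∈ Icc (0:ℝ) T) (hT : T ≤ 1) (ξ : EuclideanSpace ℝ (Fin 2)) :
    ENNReal.ofReal ((1 + ‖ξ‖ ^ 2) ^ ((1:ℝ)/4)) * ‖waveConv w t ξ‖ₑ ≤
      ENNReal.ofReal √2 *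
        ∫⁻ s in Icc (0:ℝ) T, ENNReal.ofReal ((1 + ‖ξ‖ ^ 2) ^ (-(1/4) : ℝ)) * ‖w s ξ‖ₑ := by
  have hb : (0:ℝ) < 1 + ‖ξ‖ ^ 2 := by positivity
  have hsqrt : (1 + ‖ξ‖ ^ 2) ^ ((1:ℝ)/4) * (√(1 + ‖ξ‖ ^ 2))⁻¹ = (1 + ‖ξ‖ ^ 2) ^ (-(1/4) : ℝ) := by
    rw [Real.sqrt_eq_rpow, ← Real.rpow_neg hb.le, ← Real.rpow_add hb]
    norm_num
  rw [waveConv, intervalIntegral.integral_of_le ht.1]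
  calc _ ≤ ENNReal.ofReal ((1 + ‖ξ‖ ^ 2) ^ ((1:ℝ)/4)) *
        ∫⁻ s in Ioc (0:ℝ) t, ‖(Real.sin ((t - s) * ‖ξ‖) / ‖ξ‖) • w s ξ‖ₑ := by
        gcongr
        exact enorm_integral_le_lintegral_enorm _
    _ = ∫⁻ s in Ioc (0:ℝ) t, ENNReal.ofReal ((1 + ‖ξ‖ ^ 2) ^ ((1:ℝ)/4)) *
          ‖(Real.sin ((t - s) * ‖ξ‖) / ‖ξ‖) • w s ξ‖ₑ :=
        (lintegral_const_mul' _ _ ENNReal.ofReal_ne_top).symm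
    _ ≤ ∫⁻ s in Ioc (0:ℝ) t, ENNReal.ofReal √2 *
          (ENNReal.ofReal ((1 + ‖ξ‖ ^ 2) ^ (-(1/4) : ℝ)) * ‖w s ξ‖ₑ) := by
        refine setLIntegral_mono' measurableSet_Ioc fun s hs ↦ ?_
        have hτ : |t - s| ≤ 1 := abs_le.2 ⟨by linarith [hs.2], by linarith [hs.1, ht.2]⟩
        rw [enorm_smul, ← mul_assoc, ← mul_assoc, Real.enorm_eq_ofReal_abs,
          ← ENNReal.ofReal_mul (by positivity), ← ENNReal.ofReal_mul (by positivity)]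
        refine mul_le_mul_left (ENNReal.ofReal_le_ofReal ?_) _
        calc _ ≤ (1 + ‖ξ‖ ^ 2) ^ ((1:ℝ)/4) * (√2 * (√(1 + ‖ξ‖ ^ 2))⁻¹) := by
              gcongr
              exact abs_sin_mul_div_le hτ
          _ = _ := by rw [← hsqrt]; ring
    _ = ENNReal.ofReal √2 *
          ∫⁻ s in Ioc (0:ℝ) t, ENNReal.ofReal ((1 + ‖ξ‖ ^ 2) ^ (-(1/4) : ℝ)) * ‖w s ξ‖ₑ :=
        lintegral_const_mul' _ _ ENNReal.ofReal_ne_top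
    _ ≤ _ := by
        gcongr
        exact Ioc_subset_Icc_self.trans (Icc_subset_Icc_right ht.2)

theorem ofReal_rpow_mul_norm_sq {E : Type*} [NormedAddCommGroup E] {b : ℝ} (hb : 0 < b) (p : ℝ)
    (z : E) :
    ENNReal.ofReal (b ^ (2 * p) * ‖z‖ ^ 2) = (ENNReal.ofReal (b ^ p) * ‖z‖ₑ) ^ 2 := by
  rw [← ofReal_norm, ← ENNReal.ofReal_mul (by positivity),
    ← ENNReal.ofReal_pow (by positivity), mul_pow, mul_comm 2 p, Real.rpow_mul hb.le,
    Real.rpow_two]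


/-- the wave-kernel smoothing estimate
`‖G∗w‖_{L^∞([0,T];W^{1/2,2})} ≲ ‖w‖_{L¹([0,T];W^{−1/2,2})}`, in Fourier variables,
with a constant independent of `T ∈ (0,1]` and `w`. -/
theorem stmt_0 :
    ∃ C : ℝ, 0 < C ∧
      ∀ T : ℝ, 0 < T → T ≤ 1 →
      ∀ w : ℝ → EuclideanSpace ℝ (Fin 2) → ℂ,
        Measurable (Function.uncurry w) →
        (∫⁻ s in Icc (0:ℝ) T,
            (∫⁻ ξ, ENNReal.ofReal ((1 + ‖ξ‖^2) ^ (-(1/2) : ℝ) * ‖w s ξ‖^2)) ^ ((1:ℝ)/2)) < ⊤ →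
        ∀ t ∈ Icc (0:ℝ) T,
          (∫⁻ ξ, ENNReal.ofReal ((1 + ‖ξ‖^2) ^ ((1:ℝ)/2) * ‖waveConv w t ξ‖^2)) ≤
            ENNReal.ofReal C *
              (∫⁻ s in Icc (0:ℝ) T,
                (∫⁻ ξ, ENNReal.ofReal ((1 + ‖ξ‖^2) ^ (-(1/2) : ℝ) * ‖w s ξ‖^2)) ^ ((1:ℝ)/2)) ^ 2 := by
  refine ⟨2, two_pos, fun T _ hT w hw _ t ht ↦ ?_⟩
  have hb (ξ : EuclideanSpace ℝ (Fin 2)) : (0:ℝ) < 1 + ‖ξ‖ ^ 2 := by positivity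
  have hpos : (1:ℝ)/2 = 2 * (1/4) := by norm_num
  have hneg : (-(1/2) : ℝ) = 2 * (-(1/4)) := by norm_num
  have hsource (s : ℝ) : ∫⁻ ξ, ENNReal.ofReal ((1 + ‖ξ‖^2) ^ (-(1/2) : ℝ) * ‖w s ξ‖^2) =
      ∫⁻ ξ, (ENNReal.ofReal ((1 + ‖ξ‖ ^ 2) ^ (-(1/4) : ℝ)) * ‖w s ξ‖ₑ) ^ 2 :=
    lintegral_congr fun ξ ↦ by rw [hneg, ofReal_rpow_mul_norm_sq (hb ξ)]
  simp only [hsource]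
  have hmeas : Measurable (Function.uncurry fun (s : ℝ) (ξ : EuclideanSpace ℝ (Fin 2)) ↦
      ENNReal.ofReal ((1 + ‖ξ‖ ^ 2) ^ (-(1/4) : ℝ)) * ‖w s ξ‖ₑ) := by
    refine Measurable.mul (f := fun p : ℝ × EuclideanSpace ℝ (Fin 2) ↦
      ENNReal.ofReal ((1 + ‖p.2‖ ^ 2) ^ (-(1/4) : ℝ))) ?_ hw.enorm
    fun_prop
  calc ∫⁻ ξ, ENNReal.ofReal ((1 + ‖ξ‖^2) ^ ((1:ℝ)/2) * ‖waveConv w t ξ‖^2)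
      ≤ ∫⁻ ξ, ENNReal.ofReal 2 * (∫⁻ s in Icc (0:ℝ) T,
          ENNReal.ofReal ((1 + ‖ξ‖ ^ 2) ^ (-(1/4) : ℝ)) * ‖w s ξ‖ₑ) ^ 2 := by
        refine lintegral_mono fun ξ ↦ ?_
        have h2 : ENNReal.ofReal 2 = ENNReal.ofReal √2 ^ 2 := by
          rw [← ENNReal.ofReal_pow (Real.sqrt_nonneg 2), Real.sq_sqrt zero_le_two]
        rw [hpos, ofReal_rpow_mul_norm_sq (hb ξ), h2, ← mul_pow]
        exact pow_le_pow_left' (rpow_mul_enorm_waveConv_le w ht hT ξ) 2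
    _ = ENNReal.ofReal 2 * ∫⁻ ξ, (∫⁻ s in Icc (0:ℝ) T,
          ENNReal.ofReal ((1 + ‖ξ‖ ^ 2) ^ (-(1/4) : ℝ)) * ‖w s ξ‖ₑ) ^ 2 :=
        lintegral_const_mul' _ _ ENNReal.ofReal_ne_top
    _ ≤ _ := by
        gcongr
        exact lintegral_lintegral_sq_le hmeas
end

section
/- For every H = (H₀,H₁,H₂) ∈ (0,1)³ and every real α > 3/2 − (H₀+H₁+H₂), the integral ∫_{ℝ²} (1+‖η‖²)^{−α} K^H(η) dη is finite. -/
open MeasureTheory Set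

/-- The kernel `K^H(η) = |η₁|^{1−2H₁}|η₂|^{1−2H₂}/(1+‖η‖^{1+2H₀})` on `ℝ²`,
where `‖η‖ = √(η₁²+η₂²)` is the Euclidean norm. -/
noncomputable def Kker (H₀ H₁ H₂ x y : ℝ) : ℝ :=
  |x| ^ (1 - 2*H₁) * |y| ^ (1 - 2*H₂) / (1 + Real.sqrt (x^2 + y^2) ^ (1 + 2*H₀))

lemma integrable_abs_rpow_mul_one_add_sq_rpow {a b : ℝ} (ha : -1 < a) (hb : 0 < b)
    (hab : 1 + a < 2 * b) :
    Integrable (fun x : ℝ => |x| ^ a * (1 + x ^ 2) ^ (-b)) := by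
  have hm : Measurable (fun x : ℝ => |x| ^ a * (1 + x ^ 2) ^ (-b)) := by fun_prop
  have hle (x : ℝ) : (1 + x ^ 2) ^ (-b) ≤ 1 :=
    Real.rpow_le_one_of_one_le_of_nonpos (by nlinarith [sq_nonneg x]) (by linarith)
  have hpos : IntegrableOn (fun x : ℝ => |x| ^ a * (1 + x ^ 2) ^ (-b)) (Ioi 0) := by
    rw [← Ioc_union_Ioi_eq_Ioi zero_le_one, integrableOn_union]
    constructor
    · have h : IntegrableOn (fun x : ℝ => x ^ a) (Ioc 0 1) :=
        (intervalIntegrable_iff_integrableOn_Ioc_of_le zero_le_one).1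
          (intervalIntegral.intervalIntegrable_rpow' ha)
      refine Integrable.mono' h hm.aestronglyMeasurable ?_
      filter_upwards [ae_restrict_mem measurableSet_Ioc] with x hx
      rw [Real.norm_of_nonneg (by positivity), abs_of_pos hx.1]
      exact mul_le_of_le_one_right (Real.rpow_nonneg hx.1.le _) (hle x)
    · have h : IntegrableOn (fun x : ℝ => x ^ (a - 2 * b)) (Ioi 1) :=
        integrableOn_Ioi_rpow_of_lt (by linarith) zero_lt_one
      refine Integrable.mono' h hm.aestronglyMeasurable ?_
      filter_upwards [ae_restrict_mem measurableSet_Ioi] with x hx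
      have hx0 : 0 < x := zero_lt_one.trans hx
      rw [Real.norm_of_nonneg (by positivity), abs_of_pos hx0, sub_eq_add_neg,
        Real.rpow_add hx0]
      gcongr
      calc (1 + x ^ 2) ^ (-b) ≤ (x ^ 2) ^ (-b) :=
            Real.rpow_le_rpow_of_nonpos (by positivity) (by linarith) (by linarith)
        _ = x ^ (-(2 * b)) := by
            rw [← Real.rpow_natCast, ← Real.rpow_mul hx0.le]; congr 1; push_cast; ring
  have hneg : IntegrableOn (fun x : ℝ => |x| ^ a * (1 + x ^ 2) ^ (-b)) (Iic 0) := by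
    have h : IntegrableOn (fun x : ℝ => |x| ^ a * (1 + x ^ 2) ^ (-b)) (Ici (-0)) := by
      rw [neg_zero]; rwa [integrableOn_Ici_iff_integrableOn_Ioi]
    simpa using h.comp_neg_Iic
  rw [← integrableOn_univ, ← Iic_union_Ioi (a := (0 : ℝ))]
  exact hneg.union hpos

lemma one_add_sq_rpow_le {r γ : ℝ} (hr : 0 ≤ r) (hγ : 0 ≤ γ) :
    (1 + r ^ 2) ^ γ ≤ 2 ^ γ * (1 + r ^ (2 * γ)) := by
  have hr' : 0 ≤ r ^ (2 * γ) := Real.rpow_nonneg hr _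
  have h2 : (0 : ℝ) ≤ 2 ^ γ := by positivity
  rcases le_total r 1 with h | h
  · calc (1 + r ^ 2) ^ γ ≤ 2 ^ γ := by gcongr; nlinarith
      _ ≤ 2 ^ γ * (1 + r ^ (2 * γ)) := le_mul_of_one_le_right h2 (by linarith)
  · calc (1 + r ^ 2) ^ γ ≤ (2 * r ^ 2) ^ γ := by gcongr; nlinarith
      _ = 2 ^ γ * r ^ (2 * γ) := by
          rw [Real.mul_rpow (by norm_num) (by positivity), ← Real.rpow_natCast,
            ← Real.rpow_mul hr]
          norm_num
      _ ≤ 2 ^ γ * (1 + r ^ (2 * γ)) := by gcongr; linarith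

lemma one_add_sq_add_sq_rpow_neg_le {b c : ℝ} (hb : 0 ≤ b) (hc : 0 ≤ c) (x y : ℝ) :
    (1 + (x ^ 2 + y ^ 2)) ^ (-(b + c)) ≤ (1 + x ^ 2) ^ (-b) * (1 + y ^ 2) ^ (-c) := by
  rw [neg_add, Real.rpow_add (by positivity)]
  gcongr ?_ * ?_
  · exact Real.rpow_le_rpow_of_nonpos (by positivity) (by nlinarith [sq_nonneg y]) (by linarith)
  · exact Real.rpow_le_rpow_of_nonpos (by positivity) (by nlinarith [sq_nonneg x]) (by linarith)

/-- for every `H ∈ (0,1)³` and every `α > 3/2 − (H₀+H₁+H₂)`, the integral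
`∫_{ℝ²} (1+‖η‖²)^{−α} K^H(η) dη` is finite. -/
theorem stmt_2 (H₀ H₁ H₂ : ℝ) (h₀ : H₀ ∈ Ioo (0:ℝ) 1) (h₁ : H₁ ∈ Ioo (0:ℝ) 1)
    (h₂ : H₂ ∈ Ioo (0:ℝ) 1) (α : ℝ) (hα : 3/2 - (H₀ + H₁ + H₂) < α) :
    (∫⁻ η : ℝ × ℝ,
        ENNReal.ofReal ((1 + (η.1^2 + η.2^2)) ^ (-α) * Kker H₀ H₁ H₂ η.1 η.2)) < ⊤ := by
  obtain ⟨h₀, -⟩ := h₀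
  obtain ⟨h₁, h₁'⟩ := h₁
  obtain ⟨h₂, h₂'⟩ := h₂
  set ε := (α - (3/2 - (H₀ + H₁ + H₂))) / 2 with hε
  have hε0 : 0 < ε := by linarith
  set b := 1 - H₁ + ε with hb
  set c := 1 - H₂ + ε with hc
  have hbc : α + (1/2 + H₀) = b + c := by rw [hb, hc, hε]; ring
  have hprod := ((integrable_abs_rpow_mul_one_add_sq_rpow (a := 1 - 2*H₁) (b := b)
    (by linarith) (by linarith) (by linarith)).mul_prod
    (integrable_abs_rpow_mul_one_add_sq_rpow (a := 1 - 2*H₂) (b := c)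
    (by linarith) (by linarith) (by linarith))).const_mul (2 ^ (1/2 + H₀))
  refine lt_of_le_of_lt (lintegral_mono fun η => ENNReal.ofReal_le_ofReal ?_)
    hprod.lintegral_lt_top
  obtain ⟨x, y⟩ := η
  have hdecay : (1 + (x^2 + y^2)) ^ (-α) / (1 + √(x^2 + y^2) ^ (1 + 2*H₀)) ≤
      2 ^ (1/2 + H₀) * ((1 + x ^ 2) ^ (-b) * (1 + y ^ 2) ^ (-c)) := by
    have hγ := one_add_sq_rpow_le (Real.sqrt_nonneg (x^2 + y^2))
      (show 0 ≤ 1/2 + H₀ by linarith)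
    rw [Real.sq_sqrt (by positivity), show 2 * (1/2 + H₀) = 1 + 2*H₀ by ring] at hγ
    calc (1 + (x^2 + y^2)) ^ (-α) / (1 + √(x^2 + y^2) ^ (1 + 2*H₀))
        ≤ 2 ^ (1/2 + H₀) * (1 + (x^2 + y^2)) ^ (-(b + c)) := by
          rw [div_le_iff₀ (by positivity), ← hbc]
          calc (1 + (x^2 + y^2)) ^ (-α)
              = (1 + (x^2 + y^2)) ^ (-(α + (1/2 + H₀))) * (1 + (x^2 + y^2)) ^ (1/2 + H₀) := by
                rw [← Real.rpow_add (by positivity)]; congr 1; ring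
            _ ≤ (1 + (x^2 + y^2)) ^ (-(α + (1/2 + H₀))) *
                  (2 ^ (1/2 + H₀) * (1 + √(x^2 + y^2) ^ (1 + 2*H₀))) := by gcongr
            _ = _ := by ring
      _ ≤ _ := by
          gcongr
          exact one_add_sq_add_sq_rpow_neg_le (by linarith) (by linarith) x y
  calc (1 + (x^2 + y^2)) ^ (-α) * Kker H₀ H₁ H₂ x y
      = |x| ^ (1 - 2*H₁) * |y| ^ (1 - 2*H₂) *
          ((1 + (x^2 + y^2)) ^ (-α) / (1 + √(x^2 + y^2) ^ (1 + 2*H₀))) := by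
        rw [Kker]; ring
    _ ≤ |x| ^ (1 - 2*H₁) * |y| ^ (1 - 2*H₂) *
          (2 ^ (1/2 + H₀) * ((1 + x ^ 2) ^ (-b) * (1 + y ^ 2) ^ (-c))) := by gcongr
    _ = _ := by ring
end

section
/- Let H = (H₀,H₁,H₂) and H̃ = (H̃₀,H̃₁,H̃₂) in (0,1)³ satisfy 0 < H₁, H̃₁ < 3/4, 0 < H₂, H̃₂ < 3/4, 1 < H₀+H₁+H₂ ≤ 5/4 and 1 < H̃₀+H̃₁+H̃₂ ≤ 5/4, and let α ∈ ( max( 3/2 − (H₀+H₁+H₂), 3/2 − (H̃₀+H̃₁+H̃₂) ), 1/2 ). Then the double integral ∫_{ℝ²} ∫_{ℝ²} (1+‖η−η̃‖²)^{−2α} K^H(η) K^{H̃}(η̃) dη dη̃ is finite. -/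
open MeasureTheory Set

/-- On the line, `|x|^s / (1 + |x|)^t` is integrable as soon as it is so near `0` and at infinity. -/
theorem integrable_abs_rpow_div_one_add_abs_rpow {s t : ℝ} (hs : -1 < s) (ht : 0 ≤ t)
    (hst : s - t < -1) : Integrable fun x : ℝ => |x| ^ s / (1 + |x|) ^ t := by
  have hmeas : Measurable fun x : ℝ => |x| ^ s / (1 + |x|) ^ t := by fun_prop
  have h_near : IntegrableOn (fun x : ℝ => |x| ^ s / (1 + |x|) ^ t) (Ioo 0 1) := by
    refine ((intervalIntegral.integrableOn_Ioo_rpow_iff zero_lt_one).2 hs).mono'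
      hmeas.aestronglyMeasurable ?_
    refine (ae_restrict_mem measurableSet_Ioo).mono fun x hx => ?_
    rw [Real.norm_of_nonneg (by positivity), abs_of_pos hx.1]
    have := hx.1
    exact div_le_self (by positivity) (Real.one_le_rpow (by linarith) ht)
  have h_far : IntegrableOn (fun x : ℝ => |x| ^ s / (1 + |x|) ^ t) (Ioi (1 / 2)) := by
    refine (integrableOn_Ioi_rpow_of_lt hst (by norm_num)).mono' hmeas.aestronglyMeasurable ?_
    refine (ae_restrict_mem measurableSet_Ioi).mono fun x hx => ?_
    have hx0 : 0 < x := lt_trans (by norm_num) (mem_Ioi.1 hx)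
    rw [Real.norm_of_nonneg (by positivity), abs_of_pos hx0, Real.rpow_sub hx0]
    gcongr
    linarith
  have h_pos : IntegrableOn (fun x : ℝ => |x| ^ s / (1 + |x|) ^ t) (Ici 0) := by
    rw [integrableOn_Ici_iff_integrableOn_Ioi]
    refine (h_near.union h_far).mono_set fun x hx => ?_
    rcases lt_or_ge x 1 with h | h
    · exact Or.inl ⟨hx, h⟩
    · exact Or.inr (lt_of_lt_of_le (by norm_num) h)
  have h_ind := (integrable_indicator_iff measurableSet_Ici).2 h_pos
  refine (h_ind.add h_ind.comp_neg).mono' hmeas.aestronglyMeasurable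
    (Filter.Eventually.of_forall fun x => ?_)
  have hx0 : 0 ≤ |x| ^ s / (1 + |x|) ^ t := by positivity
  rw [Real.norm_of_nonneg hx0]
  rcases le_total 0 x with h | h
  · simp only [Pi.add_apply, indicator, mem_Ici, h, if_true, abs_neg]
    split_ifs <;> linarith
  · have h' : 0 ≤ -x := by linarith
    simp only [Pi.add_apply, indicator, mem_Ici, h', if_true, abs_neg]
    split_ifs <;> linarith

theorem measurable_Kker (H₀ H₁ H₂ : ℝ) :
    Measurable fun z : ℝ × ℝ => Kker H₀ H₁ H₂ z.1 z.2 := by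
  unfold Kker
  fun_prop

theorem Kker_nonneg (H₀ H₁ H₂ x y : ℝ) : 0 ≤ Kker H₀ H₁ H₂ x y := by
  unfold Kker
  positivity

theorem one_add_rpow_le {m u : ℝ} (hm : 0 ≤ m) (hu : 0 ≤ u) :
    (1 + u) ^ m ≤ 2 ^ m * (1 + u ^ m) := by
  have hum : 0 ≤ u ^ m := by positivity
  have h2 : (0 : ℝ) ≤ 2 ^ m := by positivity
  rcases le_total u 1 with h | h
  · calc (1 + u) ^ m ≤ 2 ^ m := by gcongr; linarith
      _ ≤ 2 ^ m * (1 + u ^ m) := le_mul_of_one_le_right h2 (by linarith)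
  · calc (1 + u) ^ m ≤ (2 * u) ^ m := by gcongr; linarith
      _ = 2 ^ m * u ^ m := Real.mul_rpow (by norm_num) hu
      _ ≤ 2 ^ m * (1 + u ^ m) := by gcongr; linarith

/-- `Kker` is dominated by a product of two functions of one variable. -/
theorem Kker_le {H₀ H₁ H₂ b₁ b₂ : ℝ} (hb₁ : 0 ≤ b₁) (hb₂ : 0 ≤ b₂) (hb : b₁ + b₂ = 1 + 2 * H₀)
    (x y : ℝ) :
    Kker H₀ H₁ H₂ x y ≤ 2 ^ (1 + 2 * H₀) *
      ((|x| ^ (1 - 2 * H₁) / (1 + |x|) ^ b₁) * (|y| ^ (1 - 2 * H₂) / (1 + |y|) ^ b₂)) := by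
  have hx : |x| ≤ √(x ^ 2 + y ^ 2) := Real.abs_le_sqrt (by nlinarith [sq_nonneg y])
  have hy : |y| ≤ √(x ^ 2 + y ^ 2) := Real.abs_le_sqrt (by nlinarith [sq_nonneg x])
  have key : (1 + |x|) ^ b₁ * (1 + |y|) ^ b₂ ≤
      2 ^ (1 + 2 * H₀) * (1 + √(x ^ 2 + y ^ 2) ^ (1 + 2 * H₀)) :=
    calc (1 + |x|) ^ b₁ * (1 + |y|) ^ b₂
        ≤ (1 + √(x ^ 2 + y ^ 2)) ^ b₁ * (1 + √(x ^ 2 + y ^ 2)) ^ b₂ := by gcongr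
      _ = (1 + √(x ^ 2 + y ^ 2)) ^ (1 + 2 * H₀) := by
        rw [← Real.rpow_add (by positivity), hb]
      _ ≤ _ := one_add_rpow_le (by linarith) (Real.sqrt_nonneg _)
  rw [Kker, div_mul_div_comm, mul_div_assoc', div_le_div_iff₀ (by positivity) (by positivity)]
  calc |x| ^ (1 - 2 * H₁) * |y| ^ (1 - 2 * H₂) * ((1 + |x|) ^ b₁ * (1 + |y|) ^ b₂)
      ≤ |x| ^ (1 - 2 * H₁) * |y| ^ (1 - 2 * H₂) *
        (2 ^ (1 + 2 * H₀) * (1 + √(x ^ 2 + y ^ 2) ^ (1 + 2 * H₀))) := by gcongr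
    _ = _ := by ring

/-- `Kker` belongs to `L^p` for `p < 2` large enough with respect to its decay at infinity. -/
theorem integrable_Kker_rpow {H₀ H₁ H₂ p : ℝ} (h₁ : H₁ < 3 / 4) (h₂ : H₂ < 3 / 4)
    (hsum : 1 < H₀ + H₁ + H₂) (hp : 0 < p) (hp2 : p ≤ 2)
    (hpH : 1 < (H₀ + H₁ + H₂ - 1 / 2) * p) :
    Integrable fun z : ℝ × ℝ => Kker H₀ H₁ H₂ z.1 z.2 ^ p := by
  have hint : ∀ a b : ℝ, -1 / 2 < a → 0 ≤ b → b - a = H₀ + H₁ + H₂ - 1 / 2 →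
      Integrable fun x : ℝ => |x| ^ (a * p) / (1 + |x|) ^ (b * p) := fun a b ha hb hab =>
    integrable_abs_rpow_div_one_add_abs_rpow (by nlinarith) (by positivity)
      (by rw [← hab] at hpH; linarith)
  set b₁ := H₀ + H₂ - H₁ + 1 / 2 with hb₁
  set b₂ := H₀ + H₁ - H₂ + 1 / 2 with hb₂
  have hb₁0 : 0 ≤ b₁ := by linarith
  have hb₂0 : 0 ≤ b₂ := by linarith
  have h := (hint (1 - 2 * H₁) b₁ (by linarith) hb₁0 (by linarith)).mul_prod
    (hint (1 - 2 * H₂) b₂ (by linarith) hb₂0 (by linarith))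
  refine (h.const_mul ((2 ^ (1 + 2 * H₀)) ^ p)).mono'
    ((measurable_Kker H₀ H₁ H₂).pow_const p).aestronglyMeasurable
    (Filter.Eventually.of_forall fun z => ?_)
  have hK := Kker_nonneg H₀ H₁ H₂ z.1 z.2
  rw [Real.norm_of_nonneg (by positivity)]
  refine (Real.rpow_le_rpow hK (Kker_le hb₁0 hb₂0 (by linarith) z.1 z.2) hp.le).trans_eq ?_
  rw [Real.mul_rpow (by positivity) (by positivity), Real.mul_rpow (by positivity) (by positivity),
    Real.div_rpow (by positivity) (by positivity), Real.div_rpow (by positivity) (by positivity)]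
  simp only [← Real.rpow_mul (abs_nonneg _), ← Real.rpow_mul (add_nonneg zero_le_one (abs_nonneg _))]

theorem integrable_one_add_sq_add_sq_rpow {s : ℝ} (hs : 1 < s) :
    Integrable fun z : ℝ × ℝ => (1 + (z.1 ^ 2 + z.2 ^ 2)) ^ (-s) := by
  have h : Integrable fun z : ℝ × ℝ => ((1 : ℝ) + ‖z‖ ^ 2) ^ (-(2 * s) / 2) :=
    integrable_rpow_neg_one_add_norm_sq (by
      rw [Module.finrank_prod, Module.finrank_self]; push_cast; linarith)
  refine h.mono' (Measurable.aestronglyMeasurable (by fun_prop)) (Filter.Eventually.of_forall fun z => ?_)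
  rw [Real.norm_of_nonneg (by positivity), show -(2 * s) / 2 = -s by ring]
  refine Real.rpow_le_rpow_of_nonpos (by positivity) ?_ (by linarith)
  rcases max_choice ‖z.1‖ ‖z.2‖ with hz | hz <;>
    rw [Prod.norm_def, hz, Real.norm_eq_abs, sq_abs] <;>
    nlinarith [sq_nonneg z.1, sq_nonneg z.2]

/-- Pointwise form of Young's convolution inequality. -/
theorem mul_mul_le_of_young {a b c β : ℝ} (ha : 0 ≤ a) (hb : 0 ≤ b) (hc : 0 ≤ c) (hβ : 0 < β)
    (hβ' : β < 1 / 2) :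
    c * a * b ≤ a ^ (1 - β)⁻¹ * b ^ (1 - β)⁻¹ + a ^ (1 - β)⁻¹ * c ^ (2 * β)⁻¹ +
      b ^ (1 - β)⁻¹ * c ^ (2 * β)⁻¹ := by
  set A := a ^ (1 - β)⁻¹ with hA
  set B := b ^ (1 - β)⁻¹ with hB
  set C := c ^ (2 * β)⁻¹ with hC
  have hA0 : 0 ≤ A := by positivity
  have hB0 : 0 ≤ B := by positivity
  have hC0 : 0 ≤ C := by positivity
  have hβ1 : 1 - β ≠ 0 := by linarith
  have haA : A ^ (1 - 2 * β) * A ^ β = a := by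
    rw [← Real.rpow_add_of_nonneg hA0 (by linarith) hβ.le, show 1 - 2 * β + β = 1 - β by ring, hA,
      Real.rpow_inv_rpow ha hβ1]
  have hbB : B ^ (1 - 2 * β) * B ^ β = b := by
    rw [← Real.rpow_add_of_nonneg hB0 (by linarith) hβ.le, show 1 - 2 * β + β = 1 - β by ring, hB,
      Real.rpow_inv_rpow hb hβ1]
  have hcC : C ^ β * C ^ β = c := by
    rw [← Real.rpow_add_of_nonneg hC0 hβ.le hβ.le, ← two_mul, hC,
      Real.rpow_inv_rpow hc (by positivity)]
  have hAB : 0 ≤ A * B := by positivity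
  have hAC : 0 ≤ A * C := by positivity
  have hBC : 0 ≤ B * C := by positivity
  calc c * a * b = (A * B) ^ (1 - 2 * β) * (A * C) ^ β * (B * C) ^ β := by
        rw [Real.mul_rpow hA0 hB0, Real.mul_rpow hA0 hC0, Real.mul_rpow hB0 hC0]
        conv_lhs => rw [← hcC, ← haA, ← hbB]
        ring
    _ ≤ (1 - 2 * β) * (A * B) + β * (A * C) + β * (B * C) :=
        Real.geom_mean_le_arith_mean3_weighted (by linarith) hβ.le hβ.le hAB hAC hBC (by ring)
    _ ≤ A * B + A * C + B * C := by nlinarith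

/-- A qualitative form of Young's convolution inequality for three functions. -/
theorem lintegral_lintegral_convolution_lt_top {E : Type*} [MeasurableSpace E] [AddCommGroup E]
    [MeasurableAdd₂ E] [MeasurableNeg E] {μ : Measure E} [SFinite μ] [μ.IsAddLeftInvariant]
    [μ.IsNegInvariant] {f g k : E → ℝ} {β : ℝ}
    (hf : Measurable f) (hg : Measurable g) (hk : Measurable k)
    (hf0 : ∀ x, 0 ≤ f x) (hg0 : ∀ x, 0 ≤ g x) (hk0 : ∀ x, 0 ≤ k x)
    (hβ : 0 < β) (hβ' : β < 1 / 2)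
    (hfi : Integrable (fun x => f x ^ (1 - β)⁻¹) μ) (hgi : Integrable (fun x => g x ^ (1 - β)⁻¹) μ)
    (hki : Integrable (fun x => k x ^ (2 * β)⁻¹) μ) :
    ∫⁻ x, ∫⁻ y, ENNReal.ofReal (k (x - y) * f x * g y) ∂μ ∂μ < ⊤ := by
  set F : E → ENNReal := fun x => ENNReal.ofReal (f x ^ (1 - β)⁻¹)
  set G : E → ENNReal := fun x => ENNReal.ofReal (g x ^ (1 - β)⁻¹)
  set K : E → ENNReal := fun x => ENNReal.ofReal (k x ^ (2 * β)⁻¹)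
  have hF : Measurable F := by fun_prop
  have hG : Measurable G := by fun_prop
  have hK : Measurable K := by fun_prop
  have hle : ∀ x y, ENNReal.ofReal (k (x - y) * f x * g y) ≤
      F x * G y + F x * K (x - y) + G y * K (x - y) := fun x y => by
    have h1 := Real.rpow_nonneg (hf0 x) (1 - β)⁻¹
    have h2 := Real.rpow_nonneg (hg0 y) (1 - β)⁻¹
    have h3 := Real.rpow_nonneg (hk0 (x - y)) (2 * β)⁻¹
    simp only [F, G, K]
    rw [← ENNReal.ofReal_mul h1, ← ENNReal.ofReal_mul h1, ← ENNReal.ofReal_mul h2,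
      ← ENNReal.ofReal_add (by positivity) (by positivity),
      ← ENNReal.ofReal_add (by positivity) (by positivity)]
    exact ENNReal.ofReal_le_ofReal
      (mul_mul_le_of_young (hf0 x) (hg0 y) (hk0 _) hβ hβ')
  have hFG : ∫⁻ x, ∫⁻ y, F x * G y ∂μ ∂μ = (∫⁻ x, F x ∂μ) * ∫⁻ y, G y ∂μ := by
    simp_rw [lintegral_const_mul _ hG]
    rw [lintegral_mul_const _ hF]
  have hFK : ∫⁻ x, ∫⁻ y, F x * K (x - y) ∂μ ∂μ = (∫⁻ x, F x ∂μ) * ∫⁻ y, K y ∂μ := by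
    have (x : E) : ∫⁻ y, F x * K (x - y) ∂μ = F x * ∫⁻ y, K y ∂μ := by
      rw [lintegral_const_mul _ (by fun_prop), lintegral_sub_left_eq_self]
    simp_rw [this]
    rw [lintegral_mul_const _ hF]
  have hGK : ∫⁻ x, ∫⁻ y, G y * K (x - y) ∂μ ∂μ = (∫⁻ y, G y ∂μ) * ∫⁻ y, K y ∂μ := by
    rw [lintegral_lintegral_swap (by fun_prop)]
    have (y : E) : ∫⁻ x, G y * K (x - y) ∂μ = G y * ∫⁻ x, K x ∂μ := by
      rw [lintegral_const_mul _ (by fun_prop), lintegral_sub_right_eq_self]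
    simp_rw [this]
    rw [lintegral_mul_const _ hG]
  have hF_top : ∫⁻ x, F x ∂μ < ⊤ := hfi.lintegral_lt_top
  have hG_top : ∫⁻ x, G x ∂μ < ⊤ := hgi.lintegral_lt_top
  have hK_top : ∫⁻ x, K x ∂μ < ⊤ := hki.lintegral_lt_top
  calc ∫⁻ x, ∫⁻ y, ENNReal.ofReal (k (x - y) * f x * g y) ∂μ ∂μ
      ≤ ∫⁻ x, ∫⁻ y, (F x * G y + F x * K (x - y) + G y * K (x - y)) ∂μ ∂μ :=
        lintegral_mono fun x => lintegral_mono fun y => hle x y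
    _ = ∫⁻ x, ((∫⁻ y, F x * G y ∂μ) + (∫⁻ y, F x * K (x - y) ∂μ) +
          ∫⁻ y, G y * K (x - y) ∂μ) ∂μ := by
        refine lintegral_congr fun x => ?_
        rw [lintegral_add_left (by fun_prop), lintegral_add_left (by fun_prop)]
    _ = (∫⁻ x, ∫⁻ y, F x * G y ∂μ ∂μ) + (∫⁻ x, ∫⁻ y, F x * K (x - y) ∂μ ∂μ) +
          ∫⁻ x, ∫⁻ y, G y * K (x - y) ∂μ ∂μ := by
        rw [lintegral_add_left (by fun_prop), lintegral_add_left (by fun_prop)]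
    _ < ⊤ := by
        rw [hFG, hFK, hGK]
        exact ENNReal.add_lt_top.2 ⟨ENNReal.add_lt_top.2
          ⟨ENNReal.mul_lt_top hF_top hG_top, ENNReal.mul_lt_top hF_top hK_top⟩,
          ENNReal.mul_lt_top hG_top hK_top⟩

/-- under the stated conditions on `H`, `H̃` and `α`, the double integral
`∬_{ℝ²×ℝ²} (1+‖η−η̃‖²)^{−2α} K^H(η) K^{H̃}(η̃) dη dη̃` is finite. -/
theorem stmt_3 (H₀ H₁ H₂ H₀' H₁' H₂' : ℝ)
    (h₀ : H₀ ∈ Ioo (0:ℝ) 1) (h₁ : H₁ ∈ Ioo (0:ℝ) 1) (h₂ : H₂ ∈ Ioo (0:ℝ) 1)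
    (h₀' : H₀' ∈ Ioo (0:ℝ) 1) (h₁' : H₁' ∈ Ioo (0:ℝ) 1) (h₂' : H₂' ∈ Ioo (0:ℝ) 1)
    (h₁34 : H₁ < 3/4) (h₂34 : H₂ < 3/4) (h₁34' : H₁' < 3/4) (h₂34' : H₂' < 3/4)
    (hsum : 1 < H₀ + H₁ + H₂) (hsum' : H₀ + H₁ + H₂ ≤ 5/4)
    (htsum : 1 < H₀' + H₁' + H₂') (htsum' : H₀' + H₁' + H₂' ≤ 5/4)
    (α : ℝ)
    (hα : max (3/2 - (H₀ + H₁ + H₂)) (3/2 - (H₀' + H₁' + H₂')) < α) (hα' : α < 1/2) :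
    (∫⁻ η : ℝ × ℝ, ∫⁻ η' : ℝ × ℝ,
        ENNReal.ofReal ((1 + ((η.1 - η'.1)^2 + (η.2 - η'.2)^2)) ^ (-(2*α)) *
          Kker H₀ H₁ H₂ η.1 η.2 * Kker H₀' H₁' H₂' η'.1 η'.2)) < ⊤ := by
  obtain ⟨β, hβl, hβα⟩ := exists_between hα
  obtain ⟨hβ, hβ'⟩ := max_lt_iff.1 hβl
  have hβ0 : 0 < β := by linarith
  have hpos : 0 < 1 - β := by linarith
  have hp2 : (1 - β)⁻¹ ≤ 2 := by
    rw [inv_le_comm₀ hpos two_pos]; linarith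
  have hk : Integrable fun z : ℝ × ℝ =>
      ((1 + (z.1 ^ 2 + z.2 ^ 2)) ^ (-(2 * α)) : ℝ) ^ (2 * β)⁻¹ := by
    have hs : 1 < 2 * α * (2 * β)⁻¹ := by
      rw [← div_eq_mul_inv, one_lt_div (by linarith)]; linarith
    refine (integrable_one_add_sq_add_sq_rpow hs).congr (Filter.Eventually.of_forall fun z => ?_)
    simp only
    rw [← Real.rpow_mul (by positivity), neg_mul]
  exact lintegral_lintegral_convolution_lt_top (μ := (volume : Measure (ℝ × ℝ)))
    (f := fun z => Kker H₀ H₁ H₂ z.1 z.2) (g := fun z => Kker H₀' H₁' H₂' z.1 z.2)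
    (k := fun z => (1 + (z.1 ^ 2 + z.2 ^ 2)) ^ (-(2 * α)))
    (measurable_Kker ..) (measurable_Kker ..) (by fun_prop)
    (fun _ => Kker_nonneg ..) (fun _ => Kker_nonneg ..) (fun _ => by positivity) hβ0 (by linarith)
    (integrable_Kker_rpow h₁34 h₂34 hsum (by positivity) hp2
      (by rw [← div_eq_mul_inv, one_lt_div hpos]; linarith))
    (integrable_Kker_rpow h₁34' h₂34' htsum (by positivity) hp2
      (by rw [← div_eq_mul_inv, one_lt_div hpos]; linarith)) hk
end

section
/- For every H = (H₀,H₁,H₂) ∈ (0,1)³ satisfying 0 < H₁ < 3/4, 0 < H₂ < 3/4 and H₀+H₁+H₂ > 1, the integral ∫_{ℝ²} |K^H(η)|² dη is finite. -/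
open MeasureTheory Set

/-- The function `|x|^a (1+|x|^p)^(-q)` is integrable on the line as soon as it is integrable
at the origin and at infinity. -/
theorem integrable_abs_rpow_mul_one_add_rpow_neg {a p q : ℝ} (ha : -1 < a) (hq : 0 ≤ q)
    (h : a - p * q < -1) :
    Integrable fun x : ℝ => |x| ^ a * (1 + |x| ^ p) ^ (-q) := by
  have hmeas : Measurable fun x : ℝ => x ^ a * (1 + x ^ p) ^ (-q) := by fun_prop
  have key : IntegrableOn (fun x : ℝ => x ^ a * (1 + x ^ p) ^ (-q)) (Ioi 0) := by
    rw [← Ioc_union_Ioi_eq_Ioi zero_le_one]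
    refine IntegrableOn.union ?_ ?_
    · have h1 : IntegrableOn (fun x : ℝ => x ^ a) (Ioc 0 1) :=
        (intervalIntegrable_iff_integrableOn_Ioc_of_le zero_le_one).1
          (intervalIntegral.intervalIntegrable_rpow' ha)
      refine h1.mono' hmeas.aestronglyMeasurable ?_
      filter_upwards [ae_restrict_mem measurableSet_Ioc] with x hx
      have hx0 : 0 < x := hx.1
      rw [Real.norm_of_nonneg (by positivity)]
      refine mul_le_of_le_one_right (by positivity) ?_
      refine Real.rpow_le_one_of_one_le_of_nonpos ?_ (by linarith)
      linarith [Real.rpow_nonneg hx0.le p]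
    · refine (integrableOn_Ioi_rpow_of_lt h one_pos).mono' hmeas.aestronglyMeasurable ?_
      filter_upwards [ae_restrict_mem measurableSet_Ioi] with x hx
      have hx0 : 0 < x := one_pos.trans hx
      rw [Real.norm_of_nonneg (by positivity), sub_eq_add_neg, Real.rpow_add hx0]
      gcongr
      rw [← mul_neg, Real.rpow_mul hx0.le]
      exact Real.rpow_le_rpow_of_nonpos (by positivity) (by linarith) (by linarith)
  have habs : IntegrableOn (fun x : ℝ => |x| ^ a * (1 + |x| ^ p) ^ (-q)) (Ioi 0) :=
    key.congr_fun (fun x hx => by simp only [abs_of_pos (mem_Ioi.1 hx)]) measurableSet_Ioi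
  have hneg : IntegrableOn (fun x : ℝ => |x| ^ a * (1 + |x| ^ p) ^ (-q)) (Iic 0) := by
    rw [integrableOn_Iic_iff_integrableOn_Iio]
    have := IntegrableOn.comp_neg_Iio (c := (0 : ℝ)) (by rwa [neg_zero])
    simpa only [abs_neg] using this
  rw [← integrableOn_univ, ← Iic_union_Ioi (a := (0 : ℝ))]
  exact hneg.union habs

/-- The squared kernel is dominated by a product of functions of one variable, the decay
being shared between the two coordinates in proportions `θ` and `1 - θ`. -/
theorem Kker_sq_le {H₀ θ : ℝ} (H₁ H₂ : ℝ) (h₀ : 0 < H₀) (hθ₀ : 0 ≤ θ) (hθ₁ : θ ≤ 1)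
    (x y : ℝ) :
    |Kker H₀ H₁ H₂ x y| ^ 2 ≤
      (|x| ^ (2 - 4 * H₁) * (1 + |x| ^ (1 + 2 * H₀)) ^ (-(2 * θ))) *
        (|y| ^ (2 - 4 * H₂) * (1 + |y| ^ (1 + 2 * H₀)) ^ (-(2 * (1 - θ)))) := by
  have hx : |x| ≤ Real.sqrt (x ^ 2 + y ^ 2) := Real.abs_le_sqrt (by nlinarith [sq_nonneg y])
  have hy : |y| ≤ Real.sqrt (x ^ 2 + y ^ 2) := Real.abs_le_sqrt (by nlinarith [sq_nonneg x])
  set r := Real.sqrt (x ^ 2 + y ^ 2)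
  have hr : 0 ≤ r := Real.sqrt_nonneg _
  have hD : 0 < 1 + r ^ (1 + 2 * H₀) := by positivity
  have sq_rpow (z c : ℝ) : (|z| ^ (1 - 2 * c)) ^ 2 = |z| ^ (2 - 4 * c) := by
    rw [← Real.rpow_mul_natCast (abs_nonneg z)]
    congr 1
    push_cast
    ring
  have hinv : ((1 + r ^ (1 + 2 * H₀)) ^ 2)⁻¹ =
      (1 + r ^ (1 + 2 * H₀)) ^ (-(2 * θ)) * (1 + r ^ (1 + 2 * H₀)) ^ (-(2 * (1 - θ))) := by
    rw [← Real.rpow_add hD, ← Real.rpow_natCast, ← Real.rpow_neg hD.le]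
    congr 1
    push_cast
    ring
  have bound {z s : ℝ} (hz : |z| ≤ r) (hs : 0 ≤ s) :
      (1 + r ^ (1 + 2 * H₀)) ^ (-(2 * s)) ≤ (1 + |z| ^ (1 + 2 * H₀)) ^ (-(2 * s)) := by
    refine Real.rpow_le_rpow_of_nonpos (by positivity) ?_ (by linarith)
    gcongr
  rw [sq_abs, Kker, div_pow, mul_pow, sq_rpow, sq_rpow, div_eq_mul_inv, hinv,
    mul_mul_mul_comm]
  exact mul_le_mul (mul_le_mul_of_nonneg_left (bound hx hθ₀) (by positivity))
    (mul_le_mul_of_nonneg_left (bound hy (by linarith)) (by positivity))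
    (by positivity) (by positivity)

/-- for `H ∈ (0,1)³` with `H₁,H₂ < 3/4` and `H₀+H₁+H₂ > 1`,
`∫_{ℝ²} |K^H(η)|² dη < ∞`. -/
theorem stmt_4 (H₀ H₁ H₂ : ℝ) (h₀ : H₀ ∈ Ioo (0:ℝ) 1) (h₁ : H₁ ∈ Ioo (0:ℝ) 1)
    (h₂ : H₂ ∈ Ioo (0:ℝ) 1) (h₁' : H₁ < 3/4) (h₂' : H₂ < 3/4)
    (hsum : 1 < H₀ + H₁ + H₂) :
    (∫⁻ η : ℝ × ℝ, ENNReal.ofReal (|Kker H₀ H₁ H₂ η.1 η.2| ^ 2)) < ⊤ := by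
  have hA : 0 < 3 - 4 * H₁ := by linarith
  have hB : 0 < 3 - 4 * H₂ := by linarith
  obtain ⟨θ, hθ⟩ : ∃ θ, θ = (3 - 4 * H₁) / ((3 - 4 * H₁) + (3 - 4 * H₂)) := ⟨_, rfl⟩
  have hθA : θ * ((3 - 4 * H₁) + (3 - 4 * H₂)) = 3 - 4 * H₁ := by
    rw [hθ]
    field_simp
  have hθ₀ : 0 < θ := by rw [hθ]; positivity
  have hθ₁ : θ < 1 := by rw [hθ, div_lt_one (by positivity)]; linarith
  have hS : (3 - 4 * H₁) + (3 - 4 * H₂) < 2 * (1 + 2 * H₀) := by linarith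
  have hf : Integrable fun x : ℝ =>
      |x| ^ (2 - 4 * H₁) * (1 + |x| ^ (1 + 2 * H₀)) ^ (-(2 * θ)) :=
    integrable_abs_rpow_mul_one_add_rpow_neg (by linarith) (by linarith)
      (by linarith [mul_lt_mul_of_pos_left hS hθ₀])
  have hg : Integrable fun y : ℝ =>
      |y| ^ (2 - 4 * H₂) * (1 + |y| ^ (1 + 2 * H₀)) ^ (-(2 * (1 - θ))) :=
    integrable_abs_rpow_mul_one_add_rpow_neg (by linarith) (by linarith)
      (by linarith [mul_lt_mul_of_pos_left hS (sub_pos.2 hθ₁)])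
  have hfg := hf.mul_prod hg
  rw [← Measure.volume_eq_prod] at hfg
  refine lt_of_le_of_lt (lintegral_mono ?_) hfg.lintegral_lt_top
  intro η
  exact ENNReal.ofReal_le_ofReal (Kker_sq_le H₁ H₂ h₀.1 hθ₀.le hθ₁.le η.1 η.2)
end

section
/- Let H = (H₀,H₁,H₂) ∈ (0,1)³ and ε ∈ (0, min(H₀, 1/4)). Then there exists a constant C > 0, depending only on H and ε, such that for every integer m ≥ 0, every t ∈ [0,1] and every η = (η₁,η₂) ∈ ℝ² with η₁ ≠ 0, η₂ ≠ 0 and ‖η‖ ≤ 2^m, one has |η₁|^{1−2H₁} |η₂|^{1−2H₂} ∫_{|ξ| ≤ 2^m} |γ_t(ξ,‖η‖)|² |ξ|^{1−2H₀} dξ ≤ C · K^{(H₀−ε, H₁, H₂)}(η). -/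
open MeasureTheory Set

/-- `γ_t(ξ,ρ) = e^{iξt} ∫₀^t e^{−iξs} (sin(sρ)/ρ) ds`. -/
noncomputable def gam (t ξ ρ : ℝ) : ℂ :=
  Complex.exp (Complex.I * ξ * t) *
    ∫ s in (0:ℝ)..t, Complex.exp (-(Complex.I * ξ * s)) * ((Real.sin (s * ρ) / ρ : ℝ) : ℂ)

open Real in
theorem integrable_abs_rpow_mul_inv_one_add_sq {a : ℝ} (ha : -1 < a) (ha' : a < 1) :
    Integrable fun x : ℝ ↦ |x| ^ a * (1 + x ^ 2)⁻¹ := by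
  have hmeas : Measurable fun x : ℝ ↦ x ^ a * (1 + x ^ 2)⁻¹ := by fun_prop
  have hIoc : IntegrableOn (fun x : ℝ ↦ x ^ a * (1 + x ^ 2)⁻¹) (Ioc 0 1) := by
    have h := (intervalIntegrable_iff_integrableOn_Ioc_of_le zero_le_one).1
      (intervalIntegral.intervalIntegrable_rpow' (a := 0) (b := 1) ha)
    refine Integrable.mono' h hmeas.aestronglyMeasurable ?_
    refine (ae_restrict_mem measurableSet_Ioc).mono fun x hx ↦ ?_
    have hx0 : 0 ≤ x ^ a := rpow_nonneg hx.1.le a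
    rw [norm_of_nonneg (by positivity)]
    exact mul_le_of_le_one_right hx0 (inv_le_one_of_one_le₀ (by nlinarith [sq_nonneg x]))
  have hIoi : IntegrableOn (fun x : ℝ ↦ x ^ a * (1 + x ^ 2)⁻¹) (Ioi 1) := by
    have h := integrableOn_Ioi_rpow_of_lt (a := a - 2) (by linarith) zero_lt_one
    refine Integrable.mono' h hmeas.aestronglyMeasurable ?_
    refine (ae_restrict_mem measurableSet_Ioi).mono fun x hx ↦ ?_
    have hx0 : 0 < x := zero_lt_one.trans hx
    have hxa : 0 ≤ x ^ a := rpow_nonneg hx0.le a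
    rw [norm_of_nonneg (by positivity), rpow_sub hx0, rpow_two, div_eq_mul_inv]
    gcongr
    linarith
  have hpos : IntegrableOn (fun x : ℝ ↦ |x| ^ a * (1 + x ^ 2)⁻¹) (Ioi 0) := by
    rw [← Ioc_union_Ioi_eq_Ioi zero_le_one]
    refine (hIoc.union hIoi).congr_fun (fun x hx ↦ ?_) (by measurability)
    have hx0 : 0 < x := by
      rcases hx with hx | hx
      · exact hx.1
      · exact zero_lt_one.trans hx
    simp only [abs_of_pos hx0]
  have hneg : IntegrableOn (fun x : ℝ ↦ |x| ^ a * (1 + x ^ 2)⁻¹) (Iic 0) := by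
    rw [integrableOn_Iic_iff_integrableOn_Iio]
    have h := (Measure.measurePreserving_neg (volume : Measure ℝ)).integrableOn_comp_preimage
      (Homeomorph.neg ℝ).measurableEmbedding
      (f := fun x : ℝ ↦ |x| ^ a * (1 + x ^ 2)⁻¹) (s := Ioi 0)
    simpa [Function.comp_def] using h.2 hpos
  rw [← integrableOn_univ, ← Iic_union_Ioi (a := (0 : ℝ))]
  exact hneg.union hpos

/-- A weight dominating `|x| ^ a / (1 + (x - ρ) ^ 2)` up to translations and the factor `ρ ^ a`. -/
noncomputable def japaneseWeight (a x : ℝ) : ℝ := (1 + |x| ^ a) * (1 + x ^ 2)⁻¹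

theorem japaneseWeight_nonneg (a x : ℝ) : 0 ≤ japaneseWeight a x := by
  unfold japaneseWeight
  positivity

theorem japaneseWeight_neg (a x : ℝ) : japaneseWeight a (-x) = japaneseWeight a x := by
  simp [japaneseWeight]

theorem integrable_japaneseWeight {a : ℝ} (ha : -1 < a) (ha' : a < 1) :
    Integrable (japaneseWeight a) := by
  have h := integrable_inv_one_add_sq.add (integrable_abs_rpow_mul_inv_one_add_sq ha ha')
  refine h.congr (Filter.Eventually.of_forall fun x ↦ ?_)
  simp only [Pi.add_apply, japaneseWeight]
  ring

open Real in
theorem abs_rpow_mul_inv_le_japaneseWeight {a ρ : ℝ} (ha : -1 < a) (ha' : a < 1) (hρ : 1 ≤ ρ)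
    (x : ℝ) : |x| ^ a * (1 + (x - ρ) ^ 2)⁻¹ ≤
      8 * ρ ^ a * (japaneseWeight a x + japaneseWeight a (x - ρ)) := by
  have hρ0 : 0 < ρ := by linarith
  have hρa : 0 < ρ ^ a := rpow_pos_of_pos hρ0 a
  have hxa : 0 ≤ |x| ^ a := rpow_nonneg (abs_nonneg x) a
  have hw := japaneseWeight_nonneg a x
  have hw' := japaneseWeight_nonneg a (x - ρ)
  rcases le_or_gt |x| (ρ / 2) with hx | hx
  · have hdist : ρ ^ 2 / 4 ≤ 1 + (x - ρ) ^ 2 := by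
      nlinarith [le_abs_self x]
    have hinv : (1 + (x - ρ) ^ 2)⁻¹ ≤ 4 * (ρ ^ a * ρ ^ (-2 - a)) := by
      rw [← rpow_add hρ0, show a + (-2 - a) = -2 by ring, rpow_neg hρ0.le, rpow_two]
      calc (1 + (x - ρ) ^ 2)⁻¹ ≤ (ρ ^ 2 / 4)⁻¹ := by gcongr
        _ = 4 * (ρ ^ 2)⁻¹ := by field_simp
    have hmain : |x| ^ a * ρ ^ (-2 - a) ≤ 2 * japaneseWeight a x := by
      unfold japaneseWeight
      rcases le_or_gt |x| 1 with h1 | h1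
      · have hx2 : x ^ 2 ≤ 1 := by rw [← sq_abs]; nlinarith [abs_nonneg x]
        have h2 : (2 : ℝ)⁻¹ ≤ (1 + x ^ 2)⁻¹ := by gcongr; linarith
        have h3 : ρ ^ (-2 - a) ≤ 1 := rpow_le_one_of_one_le_of_nonpos hρ (by linarith)
        nlinarith [mul_le_mul_of_nonneg_left h3 hxa, mul_le_mul_of_nonneg_left h2 hxa]
      · have hx0 : 0 < |x| := by linarith
        have h2 : ρ ^ (-2 - a) ≤ |x| ^ (-2 - a) :=
          rpow_le_rpow_of_nonpos hx0 (by linarith) (by linarith)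
        have h3 : |x| ^ a * |x| ^ (-2 - a) = (x ^ 2)⁻¹ := by
          rw [← rpow_add hx0, show a + (-2 - a) = -2 by ring, rpow_neg hx0.le, rpow_two, sq_abs]
        have hx2 : 1 ≤ x ^ 2 := by rw [← sq_abs]; nlinarith
        have h4 : (x ^ 2)⁻¹ ≤ 2 * (1 + x ^ 2)⁻¹ := by
          rw [← div_eq_mul_inv, inv_eq_one_div, div_le_div_iff₀ (by positivity) (by positivity)]
          linarith
        have h5 : 0 ≤ |x| ^ a * (1 + x ^ 2)⁻¹ := by positivity
        nlinarith [mul_le_mul_of_nonneg_left h2 hxa]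
    calc |x| ^ a * (1 + (x - ρ) ^ 2)⁻¹ ≤ |x| ^ a * (4 * (ρ ^ a * ρ ^ (-2 - a))) := by gcongr
      _ = 4 * ρ ^ a * (|x| ^ a * ρ ^ (-2 - a)) := by ring
      _ ≤ 4 * ρ ^ a * (2 * japaneseWeight a x) := by gcongr
      _ ≤ _ := by nlinarith [mul_nonneg hρa.le hw']
  · have hy : 0 ≤ |x - ρ| ^ a := rpow_nonneg (abs_nonneg _) a
    have hbound : |x| ^ a ≤ 8 * ρ ^ a * (1 + |x - ρ| ^ a) := by
      rcases le_or_gt 0 a with h0 | h0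
      · have hρ1 : 1 ≤ ρ ^ a := one_le_rpow hρ h0
        have h1 : |x| ≤ ρ + |x - ρ| := by
          have := abs_add_le ρ (x - ρ)
          rwa [add_sub_cancel, abs_of_pos hρ0] at this
        have h2 : |x| ^ a ≤ ρ ^ a + |x - ρ| ^ a :=
          (rpow_le_rpow (abs_nonneg x) h1 h0).trans
            (rpow_add_le_add_rpow hρ0.le (abs_nonneg _) h0 ha'.le)
        nlinarith [mul_nonneg (sub_nonneg.2 hρ1) hy]
      · have h1 : |x| ^ a ≤ (ρ / 2) ^ a := rpow_le_rpow_of_nonpos (by linarith) hx.le h0.le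
        have h2 : (2 : ℝ)⁻¹ ≤ 2 ^ a := by
          rw [← rpow_neg_one]
          exact rpow_le_rpow_of_exponent_le (by norm_num) ha.le
        have h3 : (ρ / 2) ^ a ≤ 2 * ρ ^ a := by
          rw [div_rpow hρ0.le (by norm_num), div_le_iff₀ (by positivity)]
          nlinarith
        nlinarith [mul_nonneg hρa.le hy]
    calc |x| ^ a * (1 + (x - ρ) ^ 2)⁻¹
        ≤ 8 * ρ ^ a * (1 + |x - ρ| ^ a) * (1 + (x - ρ) ^ 2)⁻¹ := by gcongr
      _ = 8 * ρ ^ a * japaneseWeight a (x - ρ) := by rw [japaneseWeight]; ring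
      _ ≤ _ := by nlinarith [mul_nonneg hρa.le hw]

/-- Decay of the Fourier transform over `[0, t]` of an amplitude with bounded derivative. -/
theorem norm_sq_integral_exp_mul_le {f f' : ℝ → ℂ} {t : ℝ} (ht : t ∈ Icc (0 : ℝ) 1) (ξ : ℝ)
    (hf : ∀ s, HasDerivAt f (f' s) s) (hf' : Continuous f')
    (hb : ∀ s ∈ Icc (0 : ℝ) 1, ‖f s‖ ≤ 1) (hb' : ∀ s, ‖f' s‖ ≤ 1) :
    ‖∫ s in (0 : ℝ)..t, Complex.exp (-(Complex.I * ξ * s)) * f s‖ ^ 2 ≤ 10 * (1 + ξ ^ 2)⁻¹ := by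
  have hE : ∀ s : ℝ, ‖Complex.exp (-(Complex.I * ξ * s))‖ = 1 := fun s ↦ by
    rw [show -(Complex.I * ξ * s) = Complex.I * ((-(ξ * s) : ℝ) : ℂ) by push_cast; ring,
      Complex.norm_exp_I_mul_ofReal]
  have hcont : Continuous f := continuous_iff_continuousAt.2 fun s ↦ (hf s).continuousAt
  have hle : ∀ g : ℝ → ℂ, (∀ s ∈ Icc (0 : ℝ) 1, ‖g s‖ ≤ 1) →
      ‖∫ s in (0 : ℝ)..t, g s‖ ≤ 1 := fun g hg ↦ by
    have h := intervalIntegral.norm_integral_le_of_norm_le_const (a := 0) (b := t) (f := g) (C := 1)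
      fun s hs ↦ by
        rw [uIoc_of_le ht.1] at hs
        exact hg s ⟨hs.1.le, hs.2.trans ht.2⟩
    rw [sub_zero, abs_of_nonneg ht.1, one_mul] at h
    exact h.trans ht.2
  set J := ∫ s in (0 : ℝ)..t, Complex.exp (-(Complex.I * ξ * s)) * f s with hJ
  have hJ1 : ‖J‖ ≤ 1 := hle _ fun s hs ↦ by rw [norm_mul, hE, one_mul]; exact hb s hs
  have hparts : -(Complex.I * ξ) * J = f t * Complex.exp (-(Complex.I * ξ * t))
      - f 0 * Complex.exp (-(Complex.I * ξ * (0 : ℝ)))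
      - ∫ s in (0 : ℝ)..t, f' s * Complex.exp (-(Complex.I * ξ * s)) := by
    have hderiv : ∀ s : ℝ, HasDerivAt (fun s : ℝ ↦ Complex.exp (-(Complex.I * ξ * s)))
        (Complex.exp (-(Complex.I * ξ * s)) * -(Complex.I * ξ)) s := fun s ↦ by
      have h := ((Complex.ofRealCLM.hasDerivAt (x := s)).const_mul (Complex.I * ξ)).neg.cexp
      simpa using h
    rw [← intervalIntegral.integral_mul_deriv_eq_deriv_mul (fun s _ ↦ hf s) (fun s _ ↦ hderiv s)
      (hf'.intervalIntegrable _ _) (Continuous.intervalIntegrable (by fun_prop) _ _), hJ,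
      ← intervalIntegral.integral_const_mul]
    exact intervalIntegral.integral_congr fun s _ ↦ by ring
  have hJξ : |ξ| * ‖J‖ ≤ 3 := by
    have h1 : ‖-(Complex.I * ξ) * J‖ = |ξ| * ‖J‖ := by simp
    rw [← h1, hparts]
    refine (norm_sub_le _ _).trans ?_
    have h2 := norm_sub_le (f t * Complex.exp (-(Complex.I * ξ * t)))
      (f 0 * Complex.exp (-(Complex.I * ξ * (0 : ℝ))))
    rw [norm_mul, norm_mul, hE, hE, mul_one, mul_one] at h2
    have h3 := hle (fun s ↦ f' s * Complex.exp (-(Complex.I * ξ * s))) fun s _ ↦ by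
      rw [norm_mul, hE, mul_one]; exact hb' s
    linarith [hb t ht, hb 0 ⟨le_rfl, zero_le_one⟩]
  rw [← div_eq_mul_inv, le_div_iff₀ (by positivity), ← sq_abs ξ]
  have h9 : (|ξ| * ‖J‖) ^ 2 ≤ 3 ^ 2 := by gcongr
  have h10 : ‖J‖ ^ 2 ≤ 1 ^ 2 := by gcongr
  nlinarith

theorem norm_gam (t ξ ρ : ℝ) : ‖gam t ξ ρ‖ =
    ‖∫ s in (0 : ℝ)..t,
      Complex.exp (-(Complex.I * ξ * s)) * ((Real.sin (s * ρ) / ρ : ℝ) : ℂ)‖ := by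
  rw [gam, norm_mul, show Complex.I * ξ * t = Complex.I * ((ξ * t : ℝ) : ℂ) by push_cast; ring,
    Complex.norm_exp_I_mul_ofReal, one_mul]

theorem norm_gam_sq_le {t ρ : ℝ} (ht : t ∈ Icc (0 : ℝ) 1) (hρ : 0 < ρ) (ξ : ℝ) :
    ‖gam t ξ ρ‖ ^ 2 ≤ 10 * (1 + ξ ^ 2)⁻¹ := by
  rw [norm_gam]
  refine norm_sq_integral_exp_mul_le (f' := fun s ↦ ((Real.cos (s * ρ) : ℝ) : ℂ)) ht ξ
    (fun s ↦ ?_) (by fun_prop) (fun s hs ↦ ?_) fun s ↦ ?_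
  · have h := (((hasDerivAt_id s).mul_const ρ).sin.div_const ρ).ofReal_comp
    simpa [hρ.ne'] using h
  · rw [Complex.norm_real, Real.norm_eq_abs, abs_div, abs_of_pos hρ, div_le_one hρ]
    refine Real.abs_sin_le_abs.trans ?_
    rw [abs_mul, abs_of_pos hρ, abs_of_nonneg hs.1]
    exact mul_le_of_le_one_left hρ.le hs.2
  · rw [Complex.norm_real]
    exact Real.abs_cos_le_one _

theorem norm_gam_sq_le_of_pos {t ρ : ℝ} (ht : t ∈ Icc (0 : ℝ) 1) (hρ : 0 < ρ) (ξ : ℝ) :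
    ‖gam t ξ ρ‖ ^ 2 ≤ 5 * (ρ ^ 2)⁻¹ * ((1 + (ξ - ρ) ^ 2)⁻¹ + (1 + (ξ + ρ) ^ 2)⁻¹) := by
  let J : ℝ → ℂ := fun κ ↦ ∫ s in (0 : ℝ)..t, Complex.exp (-(Complex.I * κ * s)) * 1
  have hJ : ∀ κ : ℝ, ‖J κ‖ ^ 2 ≤ 10 * (1 + κ ^ 2)⁻¹ := fun κ ↦
    norm_sq_integral_exp_mul_le (f := fun _ ↦ 1) (f' := fun _ ↦ 0) ht κ
      (fun s ↦ hasDerivAt_const s 1) continuous_const (by simp) (by simp)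
  have hρc : (ρ : ℂ) ≠ 0 := by exact_mod_cast hρ.ne'
  have hint : (∫ s in (0 : ℝ)..t,
      Complex.exp (-(Complex.I * ξ * s)) * ((Real.sin (s * ρ) / ρ : ℝ) : ℂ)) =
      (2 * Complex.I * ρ)⁻¹ * (J (ξ - ρ) - J (ξ + ρ)) := by
    rw [← intervalIntegral.integral_sub
      (Continuous.intervalIntegrable (by fun_prop) _ _)
      (Continuous.intervalIntegrable (by fun_prop) _ _), ← intervalIntegral.integral_const_mul]
    refine intervalIntegral.integral_congr fun s _ ↦ ?_
    have h1 : Complex.exp (-(Complex.I * ((ξ - ρ : ℝ) : ℂ) * s)) =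
        Complex.exp (-(Complex.I * ξ * s)) * Complex.exp (s * ρ * Complex.I) := by
      rw [← Complex.exp_add]; congr 1; push_cast; ring
    have h2 : Complex.exp (-(Complex.I * ((ξ + ρ : ℝ) : ℂ) * s)) =
        Complex.exp (-(Complex.I * ξ * s)) * Complex.exp (-(s * ρ) * Complex.I) := by
      rw [← Complex.exp_add]; congr 1; push_cast; ring
    simp only [h1, h2]
    push_cast
    rw [Complex.sin]
    generalize Complex.exp (-(s * ρ) * Complex.I) = p, Complex.exp (s * ρ * Complex.I) = q
    field_simp
    linear_combination (p - q) * Complex.I_sq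
  rw [norm_gam, hint, norm_mul, mul_pow]
  have hnorm : ‖(2 * Complex.I * (ρ : ℂ))⁻¹‖ ^ 2 = 4⁻¹ * (ρ ^ 2)⁻¹ := by
    simp [abs_of_pos hρ]
    ring
  have hsub : ‖J (ξ - ρ) - J (ξ + ρ)‖ ^ 2 ≤ 2 * (‖J (ξ - ρ)‖ ^ 2 + ‖J (ξ + ρ)‖ ^ 2) := by
    have h1 : ‖J (ξ - ρ) - J (ξ + ρ)‖ ^ 2 ≤ (‖J (ξ - ρ)‖ + ‖J (ξ + ρ)‖) ^ 2 := by
      gcongr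
      exact norm_sub_le _ _
    nlinarith [sq_nonneg (‖J (ξ - ρ)‖ - ‖J (ξ + ρ)‖)]
  rw [hnorm]
  calc 4⁻¹ * (ρ ^ 2)⁻¹ * ‖J (ξ - ρ) - J (ξ + ρ)‖ ^ 2
      ≤ 4⁻¹ * (ρ ^ 2)⁻¹ * (2 * (10 * (1 + (ξ - ρ) ^ 2)⁻¹ + 10 * (1 + (ξ + ρ) ^ 2)⁻¹)) := by
        gcongr
        linarith [hJ (ξ - ρ), hJ (ξ + ρ)]
    _ = _ := by ring

open Real in
theorem norm_gam_sq_mul_rpow_le {a b t ρ : ℝ} (ha : -1 < a) (ha' : a < 1) (hb : 0 ≤ b)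
    (hab : a + b ≤ 2) (ht : t ∈ Icc (0 : ℝ) 1) (hρ : 0 < ρ) (ξ : ℝ) :
    ‖gam t ξ ρ‖ ^ 2 * |ξ| ^ a ≤ 80 * (1 + ρ ^ b)⁻¹ *
      (2 * japaneseWeight a ξ + japaneseWeight a (ξ - ρ) + japaneseWeight a (ξ + ρ)) := by
  have hw := japaneseWeight_nonneg a ξ
  have hw₁ := japaneseWeight_nonneg a (ξ - ρ)
  have hw₂ := japaneseWeight_nonneg a (ξ + ρ)
  have hξa : 0 ≤ |ξ| ^ a := rpow_nonneg (abs_nonneg ξ) a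
  have hρb : 0 < ρ ^ b := rpow_pos_of_pos hρ b
  rcases le_or_gt ρ 1 with h1 | h1
  · have hinv : (2 : ℝ)⁻¹ ≤ (1 + ρ ^ b)⁻¹ := by
      gcongr
      linarith [rpow_le_one hρ.le h1 hb]
    calc ‖gam t ξ ρ‖ ^ 2 * |ξ| ^ a ≤ 10 * (1 + ξ ^ 2)⁻¹ * |ξ| ^ a := by
          gcongr
          exact norm_gam_sq_le ht hρ ξ
      _ ≤ 10 * japaneseWeight a ξ := by
          have : 0 ≤ (1 + ξ ^ 2)⁻¹ := by positivity
          rw [japaneseWeight]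
          nlinarith
      _ ≤ 80 * 2⁻¹ *
          (2 * japaneseWeight a ξ + japaneseWeight a (ξ - ρ) + japaneseWeight a (ξ + ρ)) := by
          linarith
      _ ≤ _ := by gcongr
  · have hsym : |ξ| ^ a * (1 + (ξ + ρ) ^ 2)⁻¹ ≤
        8 * ρ ^ a * (japaneseWeight a ξ + japaneseWeight a (ξ + ρ)) := by
      have h := abs_rpow_mul_inv_le_japaneseWeight ha ha' h1.le (-ξ)
      rwa [abs_neg, show -ξ - ρ = -(ξ + ρ) by ring, neg_sq, japaneseWeight_neg,
        japaneseWeight_neg] at h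
    have hpow : (ρ ^ 2)⁻¹ * ρ ^ a ≤ 2 * (1 + ρ ^ b)⁻¹ := by
      have h2 : ρ ^ a * ρ ^ b ≤ ρ ^ 2 := by
        rw [← rpow_add hρ, ← rpow_two]
        exact rpow_le_rpow_of_exponent_le h1.le hab
      have h3 : ρ ^ a ≤ ρ ^ 2 := by
        rw [← rpow_two]
        exact rpow_le_rpow_of_exponent_le h1.le (by linarith)
      rw [← div_eq_mul_inv, inv_mul_eq_div, div_le_div_iff₀ (by positivity) (by positivity)]
      linarith
    calc ‖gam t ξ ρ‖ ^ 2 * |ξ| ^ a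
        ≤ 5 * (ρ ^ 2)⁻¹ * ((1 + (ξ - ρ) ^ 2)⁻¹ + (1 + (ξ + ρ) ^ 2)⁻¹) * |ξ| ^ a := by
          gcongr
          exact norm_gam_sq_le_of_pos ht hρ ξ
      _ = 5 * (ρ ^ 2)⁻¹ *
          (|ξ| ^ a * (1 + (ξ - ρ) ^ 2)⁻¹ + |ξ| ^ a * (1 + (ξ + ρ) ^ 2)⁻¹) := by ring
      _ ≤ 5 * (ρ ^ 2)⁻¹ * (8 * ρ ^ a * (japaneseWeight a ξ + japaneseWeight a (ξ - ρ)) +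
          8 * ρ ^ a * (japaneseWeight a ξ + japaneseWeight a (ξ + ρ))) := by
          gcongr ?_ * (?_ + ?_)
          exact abs_rpow_mul_inv_le_japaneseWeight ha ha' h1.le ξ
      _ = 40 * ((ρ ^ 2)⁻¹ * ρ ^ a) *
          (2 * japaneseWeight a ξ + japaneseWeight a (ξ - ρ) + japaneseWeight a (ξ + ρ)) := by
          ring
      _ ≤ 40 * (2 * (1 + ρ ^ b)⁻¹) *
          (2 * japaneseWeight a ξ + japaneseWeight a (ξ - ρ) + japaneseWeight a (ξ + ρ)) := by
          gcongr
      _ = _ := by ring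

theorem lintegral_norm_gam_sq_mul_rpow_le {a b t ρ : ℝ} (ha : -1 < a) (ha' : a < 1) (hb : 0 ≤ b)
    (hab : a + b ≤ 2) (ht : t ∈ Icc (0 : ℝ) 1) (hρ : 0 < ρ) :
    ∫⁻ ξ, ENNReal.ofReal (‖gam t ξ ρ‖ ^ 2 * |ξ| ^ a) ≤
      ENNReal.ofReal (320 * (∫ x, japaneseWeight a x) * (1 + ρ ^ b)⁻¹) := by
  have hint := integrable_japaneseWeight ha ha'
  have hsub : Integrable fun ξ ↦ japaneseWeight a (ξ - ρ) := hint.comp_sub_right ρ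
  have hadd : Integrable fun ξ ↦ japaneseWeight a (ξ + ρ) := hint.comp_add_right ρ
  have h2 : Integrable fun ξ ↦ 2 * japaneseWeight a ξ := hint.const_mul 2
  have h2sub : Integrable fun ξ ↦ 2 * japaneseWeight a ξ + japaneseWeight a (ξ - ρ) :=
    h2.add hsub
  have hall : Integrable fun ξ ↦
      2 * japaneseWeight a ξ + japaneseWeight a (ξ - ρ) + japaneseWeight a (ξ + ρ) :=
    h2sub.add hadd
  refine (lintegral_mono fun ξ ↦ ENNReal.ofReal_le_ofReal
    (norm_gam_sq_mul_rpow_le ha ha' hb hab ht hρ ξ)).trans_eq ?_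
  rw [← ofReal_integral_eq_lintegral_ofReal (hall.const_mul _)
    (Filter.Eventually.of_forall fun ξ ↦ ?_)]
  · rw [integral_const_mul, integral_add h2sub hadd, integral_add h2 hsub, integral_const_mul,
      integral_sub_right_eq_self (japaneseWeight a) ρ,
      integral_add_right_eq_self (japaneseWeight a) ρ]
    ring_nf
  · have hw := japaneseWeight_nonneg a
    exact mul_nonneg (by positivity)
      (add_nonneg (add_nonneg (mul_nonneg zero_le_two (hw _)) (hw _)) (hw _))

/-- bound `|L^{H,(m,m)}_{t,t}(η)| ≲ K^{(H₀−ε,H₁,H₂)}(η)` uniformly in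
`m`, `t ∈ [0,1]` and `η` with `‖η‖ ≤ 2^m`. -/
theorem stmt_6 (H₀ H₁ H₂ : ℝ) (h₀ : H₀ ∈ Ioo (0:ℝ) 1) (h₁ : H₁ ∈ Ioo (0:ℝ) 1)
    (h₂ : H₂ ∈ Ioo (0:ℝ) 1) (ε : ℝ) (hε : 0 < ε) (hε' : ε < min H₀ (1/4)) :
    ∃ C : ℝ, 0 < C ∧ ∀ m : ℕ, ∀ t ∈ Icc (0:ℝ) 1, ∀ η₁ η₂ : ℝ, η₁ ≠ 0 → η₂ ≠ 0 →
      Real.sqrt (η₁^2 + η₂^2) ≤ 2^m →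
      ENNReal.ofReal (|η₁| ^ (1 - 2*H₁) * |η₂| ^ (1 - 2*H₂)) *
        (∫⁻ ξ in {ξ : ℝ | |ξ| ≤ 2^m},
          ENNReal.ofReal (‖gam t ξ (Real.sqrt (η₁^2 + η₂^2))‖^2 * |ξ| ^ (1 - 2*H₀))) ≤
      ENNReal.ofReal (C * Kker (H₀ - ε) H₁ H₂ η₁ η₂) := by
  obtain ⟨hεH, -⟩ := lt_min_iff.1 hε'
  have hI : 0 ≤ ∫ x, japaneseWeight (1 - 2 * H₀) x :=
    integral_nonneg (japaneseWeight_nonneg _)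
  refine ⟨320 * (∫ x, japaneseWeight (1 - 2 * H₀) x) + 1, by positivity,
    fun m t ht η₁ η₂ hη₁ hη₂ _ ↦ ?_⟩
  have hρ : 0 < Real.sqrt (η₁ ^ 2 + η₂ ^ 2) := Real.sqrt_pos.2 (by positivity)
  refine (mul_le_mul_right ((setLIntegral_le_lintegral _ _).trans
    (lintegral_norm_gam_sq_mul_rpow_le (b := 1 + 2 * (H₀ - ε)) (by linarith [h₀.2])
      (by linarith [h₀.1]) (by linarith) (by linarith) ht hρ)) _).trans ?_
  rw [← ENNReal.ofReal_mul (by positivity)]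
  refine ENNReal.ofReal_le_ofReal ?_
  rw [Kker, div_eq_mul_inv, mul_left_comm _ (_ * _) (_)⁻¹]
  gcongr
  linarith
end

section
/- There exists a constant c > 0 with the following property: for every H₀ ∈ (0,1) there exists a function Q : [0,1] × (1,∞) → ℝ such that (a) for every n ≥ 1, every t ∈ [0,1] and every ρ ∈ (1, 2ⁿ), one has Γ^{H₀,n}_t(ρ) ≥ c·t·ρ^{−(1+2H₀)} + Q_t(ρ) and c·t·ρ^{−(1+2H₀)} + Q_t(ρ) ≥ 0; and (b) for every ε > 0 there exists a constant c_{ε,H₀} > 0 such that sup_{t ∈ [0,1]} |Q_t(ρ)| ≤ c_{ε,H₀} · ρ^{−(2+2H₀−ε)} for all ρ > 1. -/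
open MeasureTheory Set

/-- `Γ^{H₀,n}_t(ρ) = ∫_{−2ⁿ}^{2ⁿ} |γ_t(ξ,ρ)|² |ξ|^{1−2H₀} dξ`. -/
noncomputable def Gam (H₀ : ℝ) (n : ℕ) (t ρ : ℝ) : ℝ :=
  ∫ ξ in Icc (-(2:ℝ)^n) ((2:ℝ)^n), ‖gam t ξ ρ‖^2 * |ξ| ^ (1 - 2*H₀)

/-- A power of the absolute value with exponent above `-1` is integrable on symmetric intervals. -/
lemma integrableOn_abs_rpow {p : ℝ} (hp : -1 < p) {M : ℝ} (hM : 0 ≤ M) :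
    IntegrableOn (fun x : ℝ => |x| ^ p) (Icc (-M) M) := by
  have h₁ : IntervalIntegrable (fun x : ℝ => |x| ^ p) volume 0 M := by
    refine (intervalIntegral.intervalIntegrable_rpow' (a := 0) (b := M) hp).congr ?_
    intro x hx
    rw [uIoc_of_le hM] at hx
    simp only [abs_of_pos hx.1]
  have h₂ : IntervalIntegrable (fun x : ℝ => |x| ^ p) volume (-M) 0 := by
    have := (IntervalIntegrable.iff_comp_neg (by simp)).mp h₁.symm
    simpa using this
  exact (intervalIntegrable_iff_integrableOn_Icc_of_le (by linarith)).mp (h₂.trans h₁)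

lemma continuous_gam (t ρ : ℝ) : Continuous fun ξ : ℝ => gam t ξ ρ := by
  unfold gam
  refine Continuous.mul (by fun_prop) ?_
  apply intervalIntegral.continuous_parametric_intervalIntegral_of_continuous'
  fun_prop

lemma integrableOn_gam (t ρ : ℝ) {p : ℝ} (hp : -1 < p) {M : ℝ} (hM : 0 ≤ M) :
    IntegrableOn (fun ξ : ℝ => ‖gam t ξ ρ‖ ^ 2 * |ξ| ^ p) (Icc (-M) M) :=
  (integrableOn_abs_rpow hp hM).continuousOn_mul
    ((continuous_gam t ρ).norm.pow 2).continuousOn isCompact_Icc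

/-- The modulus of `gam` dominates the sine transform of its kernel. -/
lemma integral_sin_mul_sin_le_norm_gam (t ξ ρ : ℝ) :
    ∫ s in (0:ℝ)..t, Real.sin (ξ * s) * (Real.sin (s * ρ) / ρ) ≤ ‖gam t ξ ρ‖ := by
  have h_exp : ‖Complex.exp (Complex.I * ξ * t)‖ = 1 := by
    rw [Complex.norm_exp]
    simp
  have h_int : IntervalIntegrable
      (fun s : ℝ => Complex.exp (-(Complex.I * ξ * s)) * ((Real.sin (s * ρ) / ρ : ℝ) : ℂ))
      volume 0 t := Continuous.intervalIntegrable (by fun_prop) _ _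
  have h_im := Complex.imCLM.intervalIntegral_comp_comm h_int
  have h_eq : ∀ s : ℝ, Complex.imCLM
      (Complex.exp (-(Complex.I * ξ * s)) * ((Real.sin (s * ρ) / ρ : ℝ) : ℂ)) =
      -(Real.sin (ξ * s) * (Real.sin (s * ρ) / ρ)) := by
    intro s
    rw [Complex.imCLM_apply, Complex.im_mul_ofReal, Complex.exp_im]
    simp
  simp only [h_eq, intervalIntegral.integral_neg, Complex.imCLM_apply] at h_im
  rw [gam, norm_mul, h_exp, one_mul]
  refine le_trans ?_ (Complex.abs_im_le_norm _)
  rw [← h_im, abs_neg]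
  exact le_abs_self _

/-- Resonance: `gam` has size of order `t / ρ` when `ξ` lies within `1 / t` below `ρ`. -/
lemma le_norm_gam {t ξ ρ : ℝ} (ht : 0 < t) (hρ : 0 < ρ) (htρ : 4 ≤ t * ρ)
    (hξ : ρ - 1 / t ≤ ξ) (hξρ : ξ ≤ ρ) : t / (8 * ρ) ≤ ‖gam t ξ ρ‖ := by
  refine le_trans ?_ (integral_sin_mul_sin_le_norm_gam t ξ ρ)
  have h_inv : 1 / t ≤ ρ / 4 := by
    rw [div_le_div_iff₀ ht (by norm_num)]
    linarith
  have h_sum : 0 < ξ + ρ := by linarith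
  have h_prod : ∀ s : ℝ, Real.sin (ξ * s) * (Real.sin (s * ρ) / ρ) =
      (1 / (2 * ρ)) * (Real.cos ((ρ - ξ) * s) - Real.cos ((ξ + ρ) * s)) := by
    intro s
    rw [show (ρ - ξ) * s = s * ρ - ξ * s by ring, show (ξ + ρ) * s = s * ρ + ξ * s by ring,
      Real.cos_sub, Real.cos_add]
    field_simp
    ring
  have h_main : t / 2 ≤ ∫ s in (0:ℝ)..t, Real.cos ((ρ - ξ) * s) := by
    have h_mono := intervalIntegral.integral_mono_on (a := 0) (b := t) (μ := volume)
      (f := fun _ => (1 / 2 : ℝ)) (g := fun s => Real.cos ((ρ - ξ) * s)) ht.le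
      (by simp) (Continuous.intervalIntegrable (by fun_prop) _ _) (by
        intro s hs
        have h₀ : 0 ≤ (ρ - ξ) * s := mul_nonneg (by linarith) hs.1
        have h₁ : (ρ - ξ) * s ≤ 1 := by
          calc (ρ - ξ) * s ≤ (1 / t) * t :=
                mul_le_mul (by linarith) hs.2 hs.1 (by positivity)
            _ = 1 := by field_simp
        have := Real.one_sub_sq_div_two_le_cos (x := (ρ - ξ) * s)
        nlinarith)
    rw [intervalIntegral.integral_const, smul_eq_mul] at h_mono
    linarith
  have h_err : ∫ s in (0:ℝ)..t, Real.cos ((ξ + ρ) * s) ≤ t / 4 := by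
    rw [intervalIntegral.integral_comp_mul_left (fun x => Real.cos x) h_sum.ne', integral_cos]
    simp only [mul_zero, Real.sin_zero, sub_zero, smul_eq_mul]
    have h_sin := Real.sin_le_one ((ξ + ρ) * t)
    rw [inv_mul_le_iff₀ h_sum]
    nlinarith
  simp only [h_prod]
  rw [intervalIntegral.integral_const_mul, intervalIntegral.integral_sub
    (Continuous.intervalIntegrable (by fun_prop) _ _)
    (Continuous.intervalIntegrable (by fun_prop) _ _)]
  calc t / (8 * ρ) = (1 / (2 * ρ)) * (t / 4) := by field_simp; norm_num
    _ ≤ _ := by gcongr; linarith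

lemma half_rpow_le_rpow {ξ ρ p : ℝ} (hρ : 0 < ρ) (hξ : ρ / 2 ≤ ξ) (hξρ : ξ ≤ ρ) (hp : p ≤ 1) :
    ρ ^ p / 2 ≤ ξ ^ p := by
  rcases le_total 0 p with h | h
  · calc ρ ^ p / 2 ≤ ρ ^ p / 2 ^ p := by
          gcongr
          simpa using Real.rpow_le_rpow_of_exponent_le (x := 2) (by norm_num) hp
      _ = (ρ / 2) ^ p := (Real.div_rpow hρ.le (by norm_num) p).symm
      _ ≤ ξ ^ p := Real.rpow_le_rpow (by positivity) hξ h
  · have := Real.rpow_le_rpow_of_nonpos (by linarith : 0 < ξ) hξρ h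
    have := Real.rpow_nonneg hρ.le p
    linarith

lemma Gam_nonneg (H₀ : ℝ) (n : ℕ) (t ρ : ℝ) : 0 ≤ Gam H₀ n t ρ :=
  integral_nonneg fun _ => by positivity

lemma le_Gam {H₀ : ℝ} (hH : H₀ ∈ Ioo (0:ℝ) 1) (n : ℕ) {t ρ : ℝ} (ht : 0 < t) (hρ : 0 < ρ)
    (hρn : ρ ≤ 2 ^ n) (htρ : 4 ≤ t * ρ) :
    1 / 128 * t * ρ ^ (-(1 + 2 * H₀)) ≤ Gam H₀ n t ρ := by
  have h_inv : 1 / t ≤ ρ / 4 := by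
    rw [div_le_div_iff₀ ht (by norm_num)]
    linarith
  have h_pos : 0 < 1 / t := by positivity
  have h_sub : Icc (ρ - 1 / t) ρ ⊆ Icc (-(2:ℝ) ^ n) (2 ^ n) :=
    Icc_subset_Icc (by linarith) hρn
  have h_int := integrableOn_gam t ρ (p := 1 - 2 * H₀) (by linarith [hH.2])
    (M := 2 ^ n) (by positivity)
  have h_mono := setIntegral_mono_on (μ := volume) (s := Icc (ρ - 1 / t) ρ)
    (f := fun _ => (t / (8 * ρ)) ^ 2 * (ρ ^ (1 - 2 * H₀) / 2))
    (integrableOn_const (by simp [Real.volume_Icc])) (h_int.mono_set h_sub) measurableSet_Icc (by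
      intro ξ hξ
      have h_half : ρ / 2 ≤ ξ := by linarith [hξ.1]
      rw [abs_of_pos (by linarith : 0 < ξ)]
      have := le_norm_gam ht hρ htρ hξ.1 hξ.2
      have := half_rpow_le_rpow (p := 1 - 2 * H₀) hρ h_half hξ.2 (by linarith [hH.1])
      gcongr)
  calc 1 / 128 * t * ρ ^ (-(1 + 2 * H₀))
      = ∫ _ in Icc (ρ - 1 / t) ρ, (t / (8 * ρ)) ^ 2 * (ρ ^ (1 - 2 * H₀) / 2) := by
        rw [setIntegral_const, Measure.real, Real.volume_Icc, sub_sub_cancel,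
          ENNReal.toReal_ofReal h_pos.le, smul_eq_mul,
          show -(1 + 2 * H₀) = (1 - 2 * H₀) - (2 : ℕ) by push_cast; ring,
          Real.rpow_sub_natCast hρ.ne']
        field_simp
        norm_num
    _ ≤ _ := h_mono
    _ ≤ Gam H₀ n t ρ := setIntegral_mono_set h_int
        (Filter.Eventually.of_forall fun _ => by positivity) h_sub.eventuallyLE

/-- there is `c > 0` such that for every `H₀ ∈ (0,1)` there is a function
`Q` with `Γ^{H₀,n}_t(ρ) ≥ c t ρ^{−(1+2H₀)} + Q_t(ρ) ≥ 0` for `n ≥ 1`, `t ∈ [0,1]`,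
`ρ ∈ (1,2ⁿ)`, and `sup_{t∈[0,1]} |Q_t(ρ)| ≤ c_{ε,H₀} ρ^{−(2+2H₀−ε)}` for all `ε > 0`, `ρ > 1`. -/
theorem stmt_8 :
    ∃ c : ℝ, 0 < c ∧ ∀ H₀ : ℝ, H₀ ∈ Ioo (0:ℝ) 1 →
      ∃ Q : ℝ → ℝ → ℝ,
        (∀ n : ℕ, 1 ≤ n → ∀ t ∈ Icc (0:ℝ) 1, ∀ ρ : ℝ, 1 < ρ → ρ < 2^n →
          c * t * ρ ^ (-(1 + 2*H₀)) + Q t ρ ≤ Gam H₀ n t ρ ∧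
          0 ≤ c * t * ρ ^ (-(1 + 2*H₀)) + Q t ρ) ∧
        (∀ ε : ℝ, 0 < ε → ∃ Cε : ℝ, 0 < Cε ∧ ∀ ρ : ℝ, 1 < ρ → ∀ t ∈ Icc (0:ℝ) 1,
          |Q t ρ| ≤ Cε * ρ ^ (-(2 + 2*H₀ - ε))) := by
  refine ⟨1 / 128, by norm_num, fun H₀ hH =>
    ⟨fun t ρ => if t * ρ < 4 then -(1 / 128 * t * ρ ^ (-(1 + 2 * H₀))) else 0, ?_, ?_⟩⟩
  · intro n _ t ht ρ hρ hρn
    dsimp only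
    split_ifs with h
    · simpa using Gam_nonneg H₀ n t ρ
    · rw [not_lt] at h
      have ht' : 0 < t := pos_of_mul_pos_left (by linarith) (by linarith : 0 ≤ ρ)
      rw [add_zero]
      exact ⟨le_Gam hH n ht' (by linarith) hρn.le h, by positivity⟩
  · intro ε hε
    refine ⟨1, one_pos, fun ρ hρ t ht => ?_⟩
    have hρ₀ : 0 < ρ := by linarith
    have ht₀ := ht.1
    dsimp only
    split_ifs with h
    · rw [abs_neg, abs_of_nonneg (by positivity), one_mul]
      calc 1 / 128 * t * ρ ^ (-(1 + 2 * H₀))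
          = 1 / 128 * (t * ρ) * ρ ^ (-(2 + 2 * H₀)) := by
            rw [show -(1 + 2 * H₀) = -(2 + 2 * H₀) + 1 by ring, Real.rpow_add_one hρ₀.ne']
            ring
        _ ≤ 1 * ρ ^ (-(2 + 2 * H₀)) := by
            gcongr
            linarith
        _ ≤ ρ ^ (-(2 + 2 * H₀ - ε)) := by
            rw [one_mul]
            exact Real.rpow_le_rpow_of_exponent_le hρ.le (by linarith)
    · rw [abs_zero]
      positivity
end

section
/- Let H = (H₀,H₁,H₂) and H̃ = (H̃₀,H̃₁,H̃₂) in (0,1)³ satisfy 0 < H₁, H̃₁ < 3/4, 0 < H₂, H̃₂ < 3/4, 1 < H₀+H₁+H₂ ≤ 5/4 and 1 < H̃₀+H̃₁+H̃₂ ≤ 5/4, and let α ∈ ( max( 3/2 − (H₀+H₁+H₂), 3/2 − (H̃₀+H̃₁+H̃₂) ), 1/2 ). Then the integral 𝒥₂ = ∫₀^∞ dη₁ ∫₀^∞ dη̃₁ ∫₀^∞ dη₂ ∫_{η₂}^{2η₂} dη̃₂ (1+η₁²+(η₂−η̃₂)²)^{−α} (1+η̃₁²+(η₂−η̃₂)²)^{−α}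 K^H((η₁,η₂)) K^{H̃}((η̃₁,η̃₂)) is finite. -/
open MeasureTheory Set

theorem lintegral_rpow_mul_one_add_rpow_neg_lt_top {p u : ℝ} (hp : -1 < p) (hu : p + 1 < u) :
    ∫⁻ x in Ioi (0:ℝ), ENNReal.ofReal (x ^ p * (1 + x) ^ (-u)) < ⊤ := by
  have hcover : Ioi (0:ℝ) = Ioc 0 1 ∪ Ioi 1 := (Ioc_union_Ioi_eq_Ioi zero_le_one).symm
  rw [hcover]
  refine (lintegral_union_le _ _ _).trans_lt (ENNReal.add_lt_top.2 ⟨?_, ?_⟩)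
  · have hint : IntegrableOn (fun x : ℝ => x ^ p) (Ioc 0 1) :=
      (intervalIntegrable_iff_integrableOn_Ioc_of_le zero_le_one).1
        (intervalIntegral.intervalIntegrable_rpow' hp)
    refine lt_of_le_of_lt (setLIntegral_mono' measurableSet_Ioc fun x hx => ?_)
      hint.setLIntegral_lt_top
    have hx0 : 0 < x := hx.1
    refine ENNReal.ofReal_le_ofReal (mul_le_of_le_one_right (by positivity) ?_)
    exact Real.rpow_le_one_of_one_le_of_nonpos (by linarith) (by linarith)
  · have hint : IntegrableOn (fun x : ℝ => x ^ (p - u)) (Ioi 1) :=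
      integrableOn_Ioi_rpow_of_lt (by linarith) one_pos
    refine lt_of_le_of_lt (setLIntegral_mono' measurableSet_Ioi fun x hx => ?_)
      hint.setLIntegral_lt_top
    have hx0 : (0:ℝ) < x := one_pos.trans hx
    refine ENNReal.ofReal_le_ofReal ?_
    rw [sub_eq_add_neg, Real.rpow_add hx0]
    exact mul_le_mul_of_nonneg_left
      (Real.rpow_le_rpow_of_nonpos hx0 (by linarith) (by linarith)) (by positivity)

theorem setLIntegral_Ioc_sub_rpow {b y : ℝ} (hb : -1 < b) (hy : 0 < y) :
    ∫⁻ z in Ioc y (2 * y), ENNReal.ofReal ((z - y) ^ b) =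
      ENNReal.ofReal (y ^ (b + 1) / (b + 1)) := by
  have hle : y ≤ 2 * y := by linarith
  have hint : IntervalIntegrable (fun z : ℝ => (z - y) ^ b) volume y (2 * y) := by
    have h : IntervalIntegrable (fun z : ℝ => z ^ b) volume (y - y) (2 * y - y) :=
      intervalIntegral.intervalIntegrable_rpow' hb
    simpa using h.comp_sub_right y
  rw [← ofReal_integral_eq_lintegral_ofReal
    ((intervalIntegrable_iff_integrableOn_Ioc_of_le hle).1 hint),
    ← intervalIntegral.integral_of_le hle,
    intervalIntegral.integral_comp_sub_right (fun z : ℝ => z ^ b),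
    integral_rpow (Or.inl hb)]
  · rw [sub_self, Real.zero_rpow (by linarith), sub_zero, two_mul, add_sub_cancel_right]
  · filter_upwards [ae_restrict_mem measurableSet_Ioc] with z hz
    exact Real.rpow_nonneg (sub_nonneg.2 hz.1.le) _

theorem one_add_rpow_le_two_rpow_mul {N q : ℝ} (hN : 0 ≤ N) (hq : 0 ≤ q) :
    (1 + N) ^ q ≤ 2 ^ q * (1 + N ^ q) := by
  rcases le_total N 1 with h | h
  · calc (1 + N) ^ q ≤ 2 ^ q := Real.rpow_le_rpow (by linarith) (by linarith) hq
      _ ≤ 2 ^ q * (1 + N ^ q) :=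
        le_mul_of_one_le_right (by positivity) (by linarith [Real.rpow_nonneg hN q])
  · calc (1 + N) ^ q ≤ (2 * N) ^ q := Real.rpow_le_rpow (by linarith) (by linarith) hq
      _ = 2 ^ q * N ^ q := Real.mul_rpow (by norm_num) hN
      _ ≤ 2 ^ q * (1 + N ^ q) := by gcongr; linarith

theorem one_add_sq_add_sq_rpow_neg_le_s9 {x r a α : ℝ} (hx : 0 < x) (hr : 0 < r)
    (ha : 0 ≤ a) (haα : a ≤ α) :
    (1 + x ^ 2 + r ^ 2) ^ (-α) ≤ x ^ (2 * a - 2 * α) * r ^ (-(2 * a)) := by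
  have key : ∀ t : ℝ, 0 < t → ∀ c : ℝ, 0 ≤ c → t ^ 2 ≤ 1 + x ^ 2 + r ^ 2 →
      (1 + x ^ 2 + r ^ 2) ^ (-c) ≤ t ^ (-(2 * c)) := by
    intro t ht c hc hle
    have h := Real.rpow_le_rpow_of_nonpos (z := -c) (by positivity) hle (by linarith)
    rwa [← Real.rpow_natCast t, ← Real.rpow_mul ht.le, Nat.cast_ofNat, mul_neg] at h
  have hsplit : -α = -(α - a) + -a := by ring
  rw [hsplit, Real.rpow_add (by positivity)]
  refine mul_le_mul ?_ (key r hr a ha (by nlinarith)) (by positivity) (by positivity)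
  have h := key x hx (α - a) (by linarith) (by nlinarith)
  rwa [show -(2 * (α - a)) = 2 * a - 2 * α by ring] at h

/-- A bound of the weighted kernel by a product of one-variable functions. -/
theorem rpow_neg_mul_Kker_le {H₀ H₁ H₂ x y r a α u : ℝ} (hx : 0 < x) (hy : 0 < y) (hr : 0 < r)
    (ha : 0 ≤ a) (haα : a ≤ α) (hu : 0 ≤ u) (huq : u ≤ 1 + 2 * H₀) :
    (1 + x ^ 2 + r ^ 2) ^ (-α) * Kker H₀ H₁ H₂ x y ≤
      2 ^ (1 + 2 * H₀) * (x ^ (1 - 2 * H₁ - 2 * α + 2 * a) * (1 + x) ^ (-u)) *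
        (y ^ (1 - 2 * H₂) * (1 + y) ^ (-(1 + 2 * H₀ - u))) * r ^ (-(2 * a)) := by
  set q := 1 + 2 * H₀
  set N := Real.sqrt (x ^ 2 + y ^ 2)
  have hxN : x ≤ N := Real.le_sqrt_of_sq_le (by nlinarith)
  have hyN : y ≤ N := Real.le_sqrt_of_sq_le (by nlinarith)
  have hN : 0 ≤ N := hx.le.trans hxN
  have hden : (1 + x) ^ u * (1 + y) ^ (q - u) ≤ 2 ^ q * (1 + N ^ q) := by
    calc (1 + x) ^ u * (1 + y) ^ (q - u) ≤ (1 + N) ^ u * (1 + N) ^ (q - u) := by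
          gcongr
      _ = (1 + N) ^ q := by rw [← Real.rpow_add (by linarith)]; congr 1; ring
      _ ≤ _ := one_add_rpow_le_two_rpow_mul hN (hu.trans huq)
  have hNq : 0 < 1 + N ^ q := by positivity
  have hinv : (1 + N ^ q)⁻¹ ≤ 2 ^ q * ((1 + x) ^ (-u) * (1 + y) ^ (-(q - u))) := by
    rw [Real.rpow_neg (by positivity), Real.rpow_neg (by positivity), ← mul_inv,
      ← div_eq_mul_inv, inv_le_iff_one_le_mul₀ hNq, div_mul_eq_mul_div,
      one_le_div (by positivity)]
    exact hden
  have hK : Kker H₀ H₁ H₂ x y ≤ x ^ (1 - 2 * H₁) * y ^ (1 - 2 * H₂) *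
      (2 ^ q * ((1 + x) ^ (-u) * (1 + y) ^ (-(q - u)))) := by
    rw [Kker, abs_of_pos hx, abs_of_pos hy, div_eq_mul_inv]
    exact mul_le_mul_of_nonneg_left hinv (by positivity)
  have hK0 : 0 ≤ Kker H₀ H₁ H₂ x y := by
    unfold Kker
    positivity
  refine (mul_le_mul (one_add_sq_add_sq_rpow_neg_le_s9 hx hr ha haα) hK hK0
    (by positivity)).trans_eq ?_
  rw [show 1 - 2 * H₁ - 2 * α + 2 * a = (2 * a - 2 * α) + (1 - 2 * H₁) by ring,
    Real.rpow_add hx]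
  ring

theorem rpow_mul_one_add_rpow_neg_le_two_mul {y z s v : ℝ} (hy : 0 < y) (hyz : y ≤ z)
    (hzy : z ≤ 2 * y) (hs : s ≤ 1) (hv : 0 ≤ v) :
    z ^ s * (1 + z) ^ (-v) ≤ 2 * (y ^ s * (1 + y) ^ (-v)) := by
  have hz : 0 < z := hy.trans_le hyz
  have h1 : z ^ s ≤ 2 * y ^ s := by
    rcases le_total 0 s with h | h
    · calc z ^ s ≤ (2 * y) ^ s := Real.rpow_le_rpow hz.le hzy h
        _ = 2 ^ s * y ^ s := Real.mul_rpow (by norm_num) hy.le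
        _ ≤ 2 * y ^ s := by
          gcongr
          simpa using Real.rpow_le_rpow_of_exponent_le (one_le_two (α := ℝ)) hs
    · have := Real.rpow_le_rpow_of_nonpos hy hyz h
      have := Real.rpow_nonneg hy.le s
      linarith
  have h2 : (1 + z) ^ (-v) ≤ (1 + y) ^ (-v) :=
    Real.rpow_le_rpow_of_nonpos (by linarith) (by linarith) (by linarith)
  calc z ^ s * (1 + z) ^ (-v) ≤ (2 * y ^ s) * (1 + y) ^ (-v) :=
        mul_le_mul h1 h2 (by positivity) (by positivity)
    _ = _ := by ring

/-- finiteness of the model integral `𝒥₂`. -/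
theorem stmt_9 (H₀ H₁ H₂ H₀' H₁' H₂' : ℝ)
    (h₀ : H₀ ∈ Ioo (0:ℝ) 1) (h₁ : H₁ ∈ Ioo (0:ℝ) 1) (h₂ : H₂ ∈ Ioo (0:ℝ) 1)
    (h₀' : H₀' ∈ Ioo (0:ℝ) 1) (h₁' : H₁' ∈ Ioo (0:ℝ) 1) (h₂' : H₂' ∈ Ioo (0:ℝ) 1)
    (h₁34 : H₁ < 3/4) (h₂34 : H₂ < 3/4) (h₁34' : H₁' < 3/4) (h₂34' : H₂' < 3/4)
    (hsum : 1 < H₀ + H₁ + H₂) (hsum' : H₀ + H₁ + H₂ ≤ 5/4)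
    (htsum : 1 < H₀' + H₁' + H₂') (htsum' : H₀' + H₁' + H₂' ≤ 5/4)
    (α : ℝ)
    (hα : max (3/2 - (H₀ + H₁ + H₂)) (3/2 - (H₀' + H₁' + H₂')) < α) (hα' : α < 1/2) :
    (∫⁻ η₁ in Ioi (0:ℝ), ∫⁻ η₁' in Ioi (0:ℝ), ∫⁻ η₂ in Ioi (0:ℝ),
        ∫⁻ η₂' in Ioc η₂ (2*η₂),
          ENNReal.ofReal ((1 + η₁^2 + (η₂ - η₂')^2) ^ (-α) *
            (1 + η₁'^2 + (η₂ - η₂')^2) ^ (-α) *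
            Kker H₀ H₁ H₂ η₁ η₂ * Kker H₀' H₁' H₂' η₁' η₂')) < ⊤ := by
  obtain ⟨hα₁, hα₂⟩ := max_lt_iff.1 hα
  obtain ⟨ε, hε, hε₁, hε₂⟩ : ∃ ε : ℝ, 0 < ε ∧
      ε < H₀ + H₁ + H₂ + α - 3/2 ∧ ε < H₀' + H₁' + H₂' + α - 3/2 := by
    obtain ⟨ε, h, h'⟩ := exists_between (lt_min
      (show 0 < H₀ + H₁ + H₂ + α - 3/2 by linarith)
      (show 0 < H₀' + H₁' + H₂' + α - 3/2 by linarith))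
    exact ⟨ε, h, lt_min_iff.1 h'⟩
  obtain ⟨a, ha, ha4, ha₁, ha₂⟩ : ∃ a : ℝ, 0 < a ∧ a < 1/4 ∧ H₁ + α - 1 < a ∧
      H₁' + α - 1 < a := by
    obtain ⟨a, h, h'⟩ := exists_between (max_lt (max_lt
      (show (0:ℝ) < 1/4 by norm_num) (show H₁ + α - 1 < 1/4 by linarith))
      (show H₁' + α - 1 < 1/4 by linarith))
    obtain ⟨h, h₂⟩ := max_lt_iff.1 h
    obtain ⟨h, h₁⟩ := max_lt_iff.1 h
    exact ⟨a, h, h', h₁, h₂⟩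
  have haα : a ≤ α := by linarith
  set p := 1 - 2 * H₁ - 2 * α + 2 * a with hp
  set p' := 1 - 2 * H₁' - 2 * α + 2 * a with hp'
  set u := p + 1 + ε with hu
  set u' := p' + 1 + ε with hu'
  set v := 1 + 2 * H₀ - u with hv
  set v' := 1 + 2 * H₀' - u' with hv'
  have hu0 : 0 ≤ u := by linarith
  have hu0' : 0 ≤ u' := by linarith
  have hv0 : 0 ≤ v := by linarith
  have hv0' : 0 ≤ v' := by linarith
  set s := (1 - 2 * H₂) + (1 - 2 * H₂') + (-(4 * a) + 1) with hs
  set c : ℝ := 2 ^ (1 + 2 * H₀) * (2 ^ (1 + 2 * H₀') * 2) with hc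
  set f : ℝ → ℝ := fun x => x ^ p * (1 + x) ^ (-u) with hf
  set f' : ℝ → ℝ := fun x => x ^ p' * (1 + x) ^ (-u') with hf'
  set g : ℝ → ℝ := fun y => c * ((y ^ (1 - 2 * H₂) * (1 + y) ^ (-v)) *
    (y ^ (1 - 2 * H₂') * (1 + y) ^ (-v'))) with hg
  have hpoint : ∀ x ∈ Ioi (0:ℝ), ∀ x' ∈ Ioi (0:ℝ), ∀ y ∈ Ioi (0:ℝ), ∀ z ∈ Ioc y (2*y),
      ENNReal.ofReal ((1 + x^2 + (y - z)^2) ^ (-α) * (1 + x'^2 + (y - z)^2) ^ (-α) *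
        Kker H₀ H₁ H₂ x y * Kker H₀' H₁' H₂' x' z) ≤
      ENNReal.ofReal (f x) * (ENNReal.ofReal (f' x') * (ENNReal.ofReal (g y) *
        ENNReal.ofReal ((z - y) ^ (-(4 * a))))) := by
    intro x (hx : 0 < x) x' (hx' : 0 < x') y (hy : 0 < y) z hz
    have hr : 0 < z - y := sub_pos.2 hz.1
    have hz0 : 0 < z := hy.trans hz.1
    have hfx : 0 ≤ f x := by positivity
    have hfx' : 0 ≤ f' x' := by positivity
    have hgy : 0 ≤ g y := by positivity
    rw [← ENNReal.ofReal_mul hgy, ← ENNReal.ofReal_mul hfx', ← ENNReal.ofReal_mul hfx]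
    refine ENNReal.ofReal_le_ofReal ?_
    have h1 := rpow_neg_mul_Kker_le (H₁ := H₁) (H₂ := H₂) hx hy hr ha.le haα hu0
      (show u ≤ 1 + 2 * H₀ by linarith)
    have h2 := rpow_neg_mul_Kker_le (H₁ := H₁') (H₂ := H₂') hx' hz0 hr ha.le haα hu0'
      (show u' ≤ 1 + 2 * H₀' by linarith)
    have h3 := rpow_mul_one_add_rpow_neg_le_two_mul hy hz.1.le hz.2
      (show 1 - 2 * H₂' ≤ 1 by linarith [h₂'.1]) hv0'
    have h2' : (1 + x' ^ 2 + (z - y) ^ 2) ^ (-α) * Kker H₀' H₁' H₂' x' z ≤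
        2 ^ (1 + 2 * H₀') * f' x' * (2 * (y ^ (1 - 2 * H₂') * (1 + y) ^ (-v'))) *
          (z - y) ^ (-(2 * a)) := by
      refine h2.trans ?_
      gcongr
    have hK0 : 0 ≤ Kker H₀' H₁' H₂' x' z := by
      unfold Kker
      positivity
    have hsq : (y - z) ^ 2 = (z - y) ^ 2 := by ring
    have hra : (z - y) ^ (-(4 * a)) = (z - y) ^ (-(2 * a)) * (z - y) ^ (-(2 * a)) := by
      rw [← Real.rpow_add hr]
      congr 1
      ring
    rw [hsq, hra]
    calc _ = ((1 + x ^ 2 + (z - y) ^ 2) ^ (-α) * Kker H₀ H₁ H₂ x y) *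
          ((1 + x' ^ 2 + (z - y) ^ 2) ^ (-α) * Kker H₀' H₁' H₂' x' z) := by ring
      _ ≤ _ := mul_le_mul h1 h2' (by positivity) (by positivity)
      _ = _ := by
        simp only [hf, hf', hg, hc]
        ring
  have hFx : ∫⁻ x in Ioi (0:ℝ), ENNReal.ofReal (f x) < ⊤ :=
    lintegral_rpow_mul_one_add_rpow_neg_lt_top (by linarith) (by linarith)
  have hFx' : ∫⁻ x in Ioi (0:ℝ), ENNReal.ofReal (f' x) < ⊤ :=
    lintegral_rpow_mul_one_add_rpow_neg_lt_top (by linarith) (by linarith)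
  have hG : ∫⁻ y in Ioi (0:ℝ), ∫⁻ z in Ioc y (2*y),
      ENNReal.ofReal (g y) * ENNReal.ofReal ((z - y) ^ (-(4 * a))) < ⊤ := by
    have heq : ∀ y ∈ Ioi (0:ℝ), ∫⁻ z in Ioc y (2*y),
        ENNReal.ofReal (g y) * ENNReal.ofReal ((z - y) ^ (-(4 * a))) =
        ENNReal.ofReal (c / (-(4 * a) + 1)) *
          ENNReal.ofReal (y ^ s * (1 + y) ^ (-(v + v'))) := by
      intro y (hy : 0 < y)
      have hgy : 0 ≤ g y := by positivity
      have ha0 : 0 < -(4 * a) + 1 := by linarith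
      rw [lintegral_const_mul' _ _ ENNReal.ofReal_ne_top,
        setLIntegral_Ioc_sub_rpow (by linarith) hy, ← ENNReal.ofReal_mul hgy,
        ← ENNReal.ofReal_mul (by positivity)]
      congr 1
      rw [hs, Real.rpow_add hy _ (-(4 * a) + 1), Real.rpow_add hy (1 - 2 * H₂), neg_add v,
        Real.rpow_add (show 0 < 1 + y by linarith)]
      simp only [hg]
      ring
    rw [setLIntegral_congr_fun measurableSet_Ioi heq,
      lintegral_const_mul' _ _ ENNReal.ofReal_ne_top]
    exact ENNReal.mul_lt_top ENNReal.ofReal_lt_top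
      (lintegral_rpow_mul_one_add_rpow_neg_lt_top (by linarith) (by linarith))
  calc _ ≤ ∫⁻ x in Ioi (0:ℝ), ∫⁻ x' in Ioi (0:ℝ), ∫⁻ y in Ioi (0:ℝ), ∫⁻ z in Ioc y (2*y),
        ENNReal.ofReal (f x) * (ENNReal.ofReal (f' x') * (ENNReal.ofReal (g y) *
          ENNReal.ofReal ((z - y) ^ (-(4 * a))))) :=
        setLIntegral_mono' measurableSet_Ioi fun x hx =>
          setLIntegral_mono' measurableSet_Ioi fun x' hx' =>
            setLIntegral_mono' measurableSet_Ioi fun y hy =>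
              setLIntegral_mono' measurableSet_Ioc fun z hz => hpoint x hx x' hx' y hy z hz
    _ = (∫⁻ x in Ioi (0:ℝ), ENNReal.ofReal (f x)) * ((∫⁻ x' in Ioi (0:ℝ),
        ENNReal.ofReal (f' x')) * ∫⁻ y in Ioi (0:ℝ), ∫⁻ z in Ioc y (2*y),
          ENNReal.ofReal (g y) * ENNReal.ofReal ((z - y) ^ (-(4 * a)))) := by
        simp only [lintegral_const_mul' _ _ ENNReal.ofReal_ne_top]
        simp only [lintegral_const_mul' _ _ ENNReal.ofReal_ne_top] at hG
        rw [lintegral_mul_const' _ _ hG.ne,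
          lintegral_mul_const' _ _ (ENNReal.mul_lt_top hFx' hG).ne]
    _ < ⊤ := ENNReal.mul_lt_top hFx (ENNReal.mul_lt_top hFx' hG)
end

section
/- Let H = (H₀,H₁,H₂) and H̃ = (H̃₀,H̃₁,H̃₂) in (0,1)³ satisfy 0 < H₁, H̃₁ < 3/4, 0 < H₂, H̃₂ < 3/4, 1 < H₀+H₁+H₂ ≤ 5/4 and 1 < H̃₀+H̃₁+H̃₂ ≤ 5/4, and let α ∈ ( max( 3/2 − (H₀+H₁+H₂), 3/2 − (H̃₀+H̃₁+H̃₂) ), 1/2 ). Then the integral 𝒥₃ = ∫₀^∞ dη₁ ∫_{η₁}^{2η₁} dη̃₁ ∫₀^∞ dη₂ ∫_{η₂}^{2η₂} dη̃₂ (1+‖η−η̃‖²)^{−2α} K^H((η₁,η₂)) K^{H̃}((η̃₁,η̃₂)) is finite, where η = (η₁,η₂) and η̃ = (η̃₁,η̃₂). -/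
open MeasureTheory Set

lemma lintegral_Ioc_sub_rpow_neg {s x : ℝ} (hs : s < 1) (hx : 0 < x) :
    ∫⁻ t in Ioc x (2 * x), ENNReal.ofReal ((t - x) ^ (-s)) =
      ENNReal.ofReal (x ^ (1 - s) / (1 - s)) := by
  have hle : x ≤ 2 * x := by linarith
  have hint : IntervalIntegrable (fun t : ℝ => (t - x) ^ (-s)) volume x (2 * x) := by
    have h := (intervalIntegral.intervalIntegrable_rpow' (a := 0) (b := x)
      (show -1 < -s by linarith)).comp_sub_right x
    convert h using 1 <;> ring
  rw [← ofReal_integral_eq_lintegral_ofReal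
      ((intervalIntegrable_iff_integrableOn_Ioc_of_le hle).1 hint)
      ((ae_restrict_iff' measurableSet_Ioc).2 (Filter.Eventually.of_forall
        fun t ht => Real.rpow_nonneg (sub_nonneg.2 ht.1.le) _)),
    ← intervalIntegral.integral_of_le hle,
    intervalIntegral.integral_comp_sub_right (fun t : ℝ => t ^ (-s)) x,
    integral_rpow (Or.inl (by linarith))]
  congr 1
  rw [sub_self, Real.zero_rpow (by linarith), show 2 * x - x = x by ring,
    show -s + 1 = 1 - s by ring, sub_zero]

lemma lintegral_Ioi_rpow_mul_one_add_rpow_neg_lt_top {p a : ℝ} (hp : -1 < p) (ha : p + 1 < a) :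
    ∫⁻ x in Ioi (0 : ℝ), ENNReal.ofReal (x ^ p * (1 + x) ^ (-a)) < ⊤ := by
  rw [← Ioc_union_Ioi_eq_Ioi (zero_le_one' ℝ)]
  refine (lintegral_union_le _ _ _).trans_lt (ENNReal.add_lt_top.2 ⟨?_, ?_⟩)
  · have hint : IntegrableOn (fun x : ℝ => x ^ p) (Ioc 0 1) :=
      (intervalIntegrable_iff_integrableOn_Ioc_of_le zero_le_one).1
        (intervalIntegral.intervalIntegrable_rpow' hp)
    refine (setLIntegral_mono' measurableSet_Ioc fun x hx => ?_).trans_lt hint.lintegral_lt_top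
    exact ENNReal.ofReal_le_ofReal (mul_le_of_le_one_right (Real.rpow_nonneg hx.1.le _)
      (Real.rpow_le_one_of_one_le_of_nonpos (by linarith [hx.1]) (by linarith)))
  · have hint : IntegrableOn (fun x : ℝ => x ^ (p - a)) (Ioi 1) :=
      integrableOn_Ioi_rpow_of_lt (by linarith) one_pos
    refine (setLIntegral_mono' measurableSet_Ioi fun x hx => ?_).trans_lt hint.lintegral_lt_top
    have hx0 : 0 < x := one_pos.trans hx
    refine ENNReal.ofReal_le_ofReal ?_
    rw [sub_eq_add_neg, Real.rpow_add hx0]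
    exact mul_le_mul_of_nonneg_left
      (Real.rpow_le_rpow_of_nonpos hx0 (by linarith) (by linarith)) (Real.rpow_nonneg hx0.le _)

lemma lintegral_lintegral_sub_rpow_mul_lt_top {s p a : ℝ} (hs : s < 1) (hp : -1 < p + (1 - s))
    (ha : p + (1 - s) + 1 < a) :
    ∫⁻ x in Ioi (0 : ℝ), ∫⁻ t in Ioc x (2 * x),
      ENNReal.ofReal ((t - x) ^ (-s) * (x ^ p * (1 + x) ^ (-a))) < ⊤ := by
  have key : ∀ x ∈ Ioi (0 : ℝ), ∫⁻ t in Ioc x (2 * x),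
      ENNReal.ofReal ((t - x) ^ (-s) * (x ^ p * (1 + x) ^ (-a))) =
      ENNReal.ofReal (1 / (1 - s)) * ENNReal.ofReal (x ^ (p + (1 - s)) * (1 + x) ^ (-a)) := by
    intro x hx
    have hx0 : 0 < x := hx
    have hc : 0 ≤ x ^ p * (1 + x) ^ (-a) := by positivity
    simp_rw [ENNReal.ofReal_mul' hc]
    rw [lintegral_mul_const' _ _ ENNReal.ofReal_ne_top, lintegral_Ioc_sub_rpow_neg hs hx0,
      ← ENNReal.ofReal_mul' hc, ← ENNReal.ofReal_mul (one_div_nonneg.2 (by linarith)),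
      Real.rpow_add hx0]
    congr 1
    ring
  rw [setLIntegral_congr_fun measurableSet_Ioi key, lintegral_const_mul' _ _ ENNReal.ofReal_ne_top]
  exact ENNReal.mul_lt_top ENNReal.ofReal_lt_top
    (lintegral_Ioi_rpow_mul_one_add_rpow_neg_lt_top hp ha)

lemma one_add_rpow_le_two_rpow_mul_s10 {r A : ℝ} (hr : 0 ≤ r) (hA : 0 ≤ A) :
    (1 + r) ^ A ≤ 2 ^ A * (1 + r ^ A) := by
  have h2 : (0 : ℝ) ≤ 2 ^ A := by positivity
  have hrA : 0 ≤ r ^ A := Real.rpow_nonneg hr A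
  rcases le_total r 1 with h | h
  · calc (1 + r) ^ A ≤ 2 ^ A := Real.rpow_le_rpow (by linarith) (by linarith) hA
      _ ≤ _ := le_mul_of_one_le_right h2 (by linarith)
  · calc (1 + r) ^ A ≤ (2 * r) ^ A := Real.rpow_le_rpow (by linarith) (by linarith) hA
      _ = 2 ^ A * r ^ A := Real.mul_rpow zero_le_two hr
      _ ≤ _ := mul_le_mul_of_nonneg_left (by linarith) h2

lemma rpow_le_two_mul_rpow {x t e : ℝ} (hx : 0 < x) (hxt : x ≤ t) (ht : t ≤ 2 * x) (he : e ≤ 1) :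
    t ^ e ≤ 2 * x ^ e := by
  have hxe : 0 < x ^ e := Real.rpow_pos_of_pos hx e
  rcases le_total e 0 with h | h
  · linarith [Real.rpow_le_rpow_of_nonpos hx hxt h]
  · calc t ^ e ≤ (2 * x) ^ e := Real.rpow_le_rpow (by linarith) ht h
      _ = 2 ^ e * x ^ e := Real.mul_rpow zero_le_two hx.le
      _ ≤ 2 * x ^ e := mul_le_mul_of_nonneg_right
          (by simpa using Real.rpow_le_rpow_of_exponent_le one_le_two he) hxe.le

lemma one_add_add_sq_rpow_neg_le {u v s : ℝ} (hu : 0 < u) (hv : 0 < v) (hs : 0 ≤ s) :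
    (1 + (u ^ 2 + v ^ 2)) ^ (-s) ≤ u ^ (-s) * v ^ (-s) := by
  rw [← Real.mul_rpow hu.le hv.le]
  exact Real.rpow_le_rpow_of_nonpos (by positivity)
    (by nlinarith [sq_nonneg (u - v), sq_nonneg u, sq_nonneg v]) (by linarith)

lemma one_div_mul_le_of_add_eq {x y r A B a b : ℝ} (hx : 0 ≤ x) (hy : 0 ≤ y) (hxr : x ≤ r)
    (hyr : y ≤ r) (hA : 0 ≤ A) (hB : 0 ≤ B) (ha : 0 ≤ a) (hb : 0 ≤ b) (hab : a + b = A + B) :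
    1 / ((1 + r ^ A) * (1 + r ^ B)) ≤
      2 ^ A * 2 ^ B * ((1 + x) ^ (-a) * (1 + y) ^ (-b)) := by
  have hr : 0 ≤ r := hx.trans hxr
  have h : (1 + x) ^ a * (1 + y) ^ b ≤ 2 ^ A * 2 ^ B * ((1 + r ^ A) * (1 + r ^ B)) := calc
    (1 + x) ^ a * (1 + y) ^ b ≤ (1 + r) ^ a * (1 + r) ^ b := by gcongr
    _ = (1 + r) ^ A * (1 + r) ^ B := by
      rw [← Real.rpow_add (by linarith), hab, Real.rpow_add (by linarith)]
    _ ≤ (2 ^ A * (1 + r ^ A)) * (2 ^ B * (1 + r ^ B)) :=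
      mul_le_mul (one_add_rpow_le_two_rpow_mul_s10 hr hA) (one_add_rpow_le_two_rpow_mul_s10 hr hB)
        (by positivity) (by positivity)
    _ = _ := by ring
  rw [Real.rpow_neg (by linarith), Real.rpow_neg (by linarith), ← mul_inv, ← div_eq_mul_inv,
    div_le_div_iff₀ (by positivity) (by positivity), one_mul]
  exact h

lemma Kker_mul_Kker_le {H₀ H₁ H₂ H₀' H₁' H₂' a b x x' y y' : ℝ}
    (h₀ : 0 ≤ H₀) (h₀' : 0 ≤ H₀') (h₁' : 0 ≤ H₁') (h₂' : 0 ≤ H₂') (ha : 0 ≤ a) (hb : 0 ≤ b)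
    (hab : a + b = (1 + 2 * H₀) + (1 + 2 * H₀'))
    (hx : 0 < x) (hx' : x' ∈ Ioc x (2 * x)) (hy : 0 < y) (hy' : y' ∈ Ioc y (2 * y)) :
    Kker H₀ H₁ H₂ x y * Kker H₀' H₁' H₂' x' y' ≤
      4 * (2 ^ (1 + 2 * H₀) * 2 ^ (1 + 2 * H₀')) *
        ((x ^ ((1 - 2 * H₁) + (1 - 2 * H₁')) * (1 + x) ^ (-a)) *
          (y ^ ((1 - 2 * H₂) + (1 - 2 * H₂')) * (1 + y) ^ (-b))) := by
  obtain ⟨hx1, hx2⟩ := hx'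
  obtain ⟨hy1, hy2⟩ := hy'
  have hx'0 : 0 < x' := hx.trans hx1
  have hy'0 : 0 < y' := hy.trans hy1
  unfold Kker
  rw [abs_of_pos hx, abs_of_pos hy, abs_of_pos hx'0, abs_of_pos hy'0, Real.rpow_add hx,
    Real.rpow_add hy]
  set r := Real.sqrt (x ^ 2 + y ^ 2) with hr
  have hr0 : 0 ≤ r := Real.sqrt_nonneg _
  have hrr : r ≤ Real.sqrt (x' ^ 2 + y' ^ 2) := Real.sqrt_le_sqrt (by gcongr)
  have hxr : x ≤ r := Real.le_sqrt_of_sq_le (by nlinarith)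
  have hyr : y ≤ r := Real.le_sqrt_of_sq_le (by nlinarith)
  have hden := one_div_mul_le_of_add_eq hx.le hy.le hxr hyr (show 0 ≤ 1 + 2 * H₀ by linarith)
    (show 0 ≤ 1 + 2 * H₀' by linarith) ha hb hab
  calc x ^ (1 - 2 * H₁) * y ^ (1 - 2 * H₂) / (1 + r ^ (1 + 2 * H₀)) *
        (x' ^ (1 - 2 * H₁') * y' ^ (1 - 2 * H₂') /
          (1 + Real.sqrt (x' ^ 2 + y' ^ 2) ^ (1 + 2 * H₀')))
      ≤ x ^ (1 - 2 * H₁) * y ^ (1 - 2 * H₂) / (1 + r ^ (1 + 2 * H₀)) *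
        ((2 * x ^ (1 - 2 * H₁')) * (2 * y ^ (1 - 2 * H₂')) / (1 + r ^ (1 + 2 * H₀'))) := by
        have e1 := rpow_le_two_mul_rpow hx hx1.le hx2 (show 1 - 2 * H₁' ≤ 1 by linarith)
        have e2 := rpow_le_two_mul_rpow hy hy1.le hy2 (show 1 - 2 * H₂' ≤ 1 by linarith)
        gcongr
    _ = 4 * (x ^ (1 - 2 * H₁) * y ^ (1 - 2 * H₂) * (x ^ (1 - 2 * H₁') * y ^ (1 - 2 * H₂'))) *
        (1 / ((1 + r ^ (1 + 2 * H₀)) * (1 + r ^ (1 + 2 * H₀')))) := by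
        rw [div_mul_div_comm]
        ring
    _ ≤ 4 * (x ^ (1 - 2 * H₁) * y ^ (1 - 2 * H₂) * (x ^ (1 - 2 * H₁') * y ^ (1 - 2 * H₂'))) *
        (2 ^ (1 + 2 * H₀) * 2 ^ (1 + 2 * H₀') * ((1 + x) ^ (-a) * (1 + y) ^ (-b))) :=
        mul_le_mul_of_nonneg_left hden (by positivity)
    _ = _ := by ring

/-- finiteness of the model integral `𝒥₃`. -/
theorem stmt_10 (H₀ H₁ H₂ H₀' H₁' H₂' : ℝ)
    (h₀ : H₀ ∈ Ioo (0:ℝ) 1) (h₁ : H₁ ∈ Ioo (0:ℝ) 1) (h₂ : H₂ ∈ Ioo (0:ℝ) 1)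
    (h₀' : H₀' ∈ Ioo (0:ℝ) 1) (h₁' : H₁' ∈ Ioo (0:ℝ) 1) (h₂' : H₂' ∈ Ioo (0:ℝ) 1)
    (h₁34 : H₁ < 3/4) (h₂34 : H₂ < 3/4) (h₁34' : H₁' < 3/4) (h₂34' : H₂' < 3/4)
    (hsum : 1 < H₀ + H₁ + H₂) (hsum' : H₀ + H₁ + H₂ ≤ 5/4)
    (htsum : 1 < H₀' + H₁' + H₂') (htsum' : H₀' + H₁' + H₂' ≤ 5/4)
    (α : ℝ)
    (hα : max (3/2 - (H₀ + H₁ + H₂)) (3/2 - (H₀' + H₁' + H₂')) < α) (hα' : α < 1/2) :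
    (∫⁻ η₁ in Ioi (0:ℝ), ∫⁻ η₁' in Ioc η₁ (2*η₁), ∫⁻ η₂ in Ioi (0:ℝ),
        ∫⁻ η₂' in Ioc η₂ (2*η₂),
          ENNReal.ofReal ((1 + ((η₁ - η₁')^2 + (η₂ - η₂')^2)) ^ (-(2*α)) *
            Kker H₀ H₁ H₂ η₁ η₂ * Kker H₀' H₁' H₂' η₁' η₂')) < ⊤ := by
  have hα₁ := (le_max_left _ _).trans_lt hα
  have hα₂ := (le_max_right _ _).trans_lt hα
  obtain ⟨h₀, -⟩ := h₀
  obtain ⟨h₀', -⟩ := h₀'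
  obtain ⟨h₁', -⟩ := h₁'
  obtain ⟨h₂', -⟩ := h₂'
  obtain ⟨p, hp⟩ : ∃ p, p = (1 - 2 * H₁) + (1 - 2 * H₁') := ⟨_, rfl⟩
  obtain ⟨q, hq⟩ : ∃ q, q = (1 - 2 * H₂) + (1 - 2 * H₂') := ⟨_, rfl⟩
  obtain ⟨s, hs⟩ : ∃ s, s = 2 * α := ⟨_, rfl⟩
  obtain ⟨a, b, ha, hb, hab⟩ : ∃ a b, p + (1 - s) + 1 < a ∧ q + (1 - s) + 1 < b ∧
      a + b = (1 + 2 * H₀) + (1 + 2 * H₀') :=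
    ⟨p + (1 - s) + 1 + ((1 + 2 * H₀) + (1 + 2 * H₀') - (p + q + 2 * (1 - s) + 2)) / 2,
      q + (1 - s) + 1 + ((1 + 2 * H₀) + (1 + 2 * H₀') - (p + q + 2 * (1 - s) + 2)) / 2,
      by linarith, by linarith, by ring⟩
  have hF := lintegral_lintegral_sub_rpow_mul_lt_top (s := s) (p := p) (a := a)
    (by linarith) (by linarith) ha
  have hG := lintegral_lintegral_sub_rpow_mul_lt_top (s := s) (p := q) (a := b)
    (by linarith) (by linarith) hb
  set F : ℝ → ℝ → ENNReal :=
    fun x t => ENNReal.ofReal ((t - x) ^ (-s) * (x ^ p * (1 + x) ^ (-a))) with hFdef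
  set G : ℝ → ℝ → ENNReal :=
    fun x t => ENNReal.ofReal ((t - x) ^ (-s) * (x ^ q * (1 + x) ^ (-b))) with hGdef
  set C : ℝ := 4 * (2 ^ (1 + 2 * H₀) * 2 ^ (1 + 2 * H₀')) with hC
  have hC0 : 0 ≤ C := by positivity
  calc _ ≤ ∫⁻ x in Ioi (0 : ℝ), ∫⁻ x' in Ioc x (2 * x), ∫⁻ y in Ioi (0 : ℝ),
        ∫⁻ y' in Ioc y (2 * y), ENNReal.ofReal C * F x x' * G y y' := by
        refine setLIntegral_mono' measurableSet_Ioi fun x hx => ?_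
        refine setLIntegral_mono' measurableSet_Ioc fun x' hx' => ?_
        refine setLIntegral_mono' measurableSet_Ioi fun y hy => ?_
        refine setLIntegral_mono' measurableSet_Ioc fun y' hy' => ?_
        have hx0 : 0 < x := hx
        have hy0 : 0 < y := hy
        have hu : 0 < x' - x := sub_pos.2 hx'.1
        have hv : 0 < y' - y := sub_pos.2 hy'.1
        rw [hFdef, hGdef, ← ENNReal.ofReal_mul hC0, ← ENNReal.ofReal_mul (by positivity)]
        refine ENNReal.ofReal_le_ofReal ?_
        have hK := Kker_mul_Kker_le (H₁ := H₁) (H₂ := H₂) h₀.le h₀'.le h₁'.le h₂'.le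
          (show 0 ≤ a by linarith) (show 0 ≤ b by linarith) hab hx0 hx' hy0 hy'
        have hK0 : 0 ≤ Kker H₀ H₁ H₂ x y * Kker H₀' H₁' H₂' x' y' := by
          unfold Kker
          positivity
        have hL := one_add_add_sq_rpow_neg_le hu hv (show 0 ≤ s by linarith)
        rw [← hp, ← hq, ← hC] at hK
        rw [← hs, mul_assoc, ← neg_sub x' x, ← neg_sub y' y, neg_sq, neg_sq]
        refine (mul_le_mul hL hK hK0 (by positivity)).trans_eq ?_
        ring
    _ = ENNReal.ofReal C * (∫⁻ x in Ioi (0 : ℝ), ∫⁻ x' in Ioc x (2 * x), F x x') *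
        ∫⁻ y in Ioi (0 : ℝ), ∫⁻ y' in Ioc y (2 * y), G y y' := by
        have hJ : ∫⁻ y in Ioi (0 : ℝ), ∫⁻ y' in Ioc y (2 * y), G y y' < ⊤ := hG
        simp_rw [fun x x' y => lintegral_const_mul' (μ := volume.restrict (Ioc y (2 * y)))
            (ENNReal.ofReal C * F x x') (G y)
            (ENNReal.mul_ne_top ENNReal.ofReal_ne_top ENNReal.ofReal_ne_top),
          fun x x' => lintegral_const_mul' (μ := volume.restrict (Ioi (0 : ℝ)))
            (ENNReal.ofReal C * F x x') (fun y => ∫⁻ y' in Ioc y (2 * y), G y y')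
            (ENNReal.mul_ne_top ENNReal.ofReal_ne_top ENNReal.ofReal_ne_top),
          lintegral_mul_const' _ _ hJ.ne,
          fun x => lintegral_const_mul' (μ := volume.restrict (Ioc x (2 * x)))
            (ENNReal.ofReal C) (F x) ENNReal.ofReal_ne_top]
        rw [lintegral_const_mul' _ _ ENNReal.ofReal_ne_top]
    _ < ⊤ := ENNReal.mul_lt_top (ENNReal.mul_lt_top ENNReal.ofReal_lt_top hF) hG
end

section
/- Let H₀ ∈ (0,1) and ε > 0. Then there exists a constant C > 0, depending only on H₀ and ε, such that for every ρ > 1 and every t ∈ [0,1], | ∫_{−ρ}^{ρ} Λ²_t(ξ,ρ) |ξ|^{1−2H₀} dξ | ≤ C · ρ^{−(2H₀+2−ε)}, where for ξ ∈ (−ρ,ρ) one sets Λ²_t(ξ,ρ) = (1 − cos(t(ξ−ρ)))/(ρ²(ξ−ρ)²) · 1_{\{ξ ≤ ρ/2\}} + cos(tρ)(cos(tξ) − cos(tρ))/(ρ²(ξ−ρ)(ξ+ρ)). -/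
open MeasureTheory Set

/-- The non-leading part `Λ²_t(ξ,ρ)` of the decomposition of `|γ_t(ξ,ρ)|²`:
`Λ²_t(ξ,ρ) = (1−cos(t(ξ−ρ)))/(ρ²(ξ−ρ)²)·1_{ξ≤ρ/2}
  + cos(tρ)(cos(tξ)−cos(tρ))/(ρ²(ξ−ρ)(ξ+ρ))`. -/
noncomputable def Lam2 (t ξ ρ : ℝ) : ℝ :=
  (if ξ ≤ ρ/2 then (1 - Real.cos (t * (ξ - ρ))) / (ρ^2 * (ξ - ρ)^2) else 0) +
    Real.cos (t * ρ) * (Real.cos (t * ξ) - Real.cos (t * ρ)) / (ρ^2 * (ξ - ρ) * (ξ + ρ))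

lemma intervalIntegrable_rpow_mul_one_sub_rpow {a b : ℝ} (ha : -1 < a) (hb : -1 < b) :
    IntervalIntegrable (fun x : ℝ ↦ x ^ a * (1 - x) ^ b) volume 0 1 := by
  have h := Complex.betaIntegral_convergent (u := ((a + 1 : ℝ) : ℂ)) (v := ((b + 1 : ℝ) : ℂ))
    (by rw [Complex.ofReal_re]; linarith) (by rw [Complex.ofReal_re]; linarith)
  rw [intervalIntegrable_iff_integrableOn_Ioo_of_le zero_le_one] at h ⊢
  refine IntegrableOn.congr_fun h.norm (fun x hx ↦ ?_) measurableSet_Ioo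
  have h1 : (1 : ℂ) - (x : ℂ) = ((1 - x : ℝ) : ℂ) := by push_cast; ring
  rw [norm_mul, h1, Complex.norm_cpow_eq_rpow_re_of_pos hx.1,
    Complex.norm_cpow_eq_rpow_re_of_pos (sub_pos.2 hx.2)]
  simp

lemma intervalIntegrable_abs_rpow_mul_one_sub_abs_rpow {a b : ℝ} (ha : -1 < a) (hb : -1 < b) :
    IntervalIntegrable (fun x : ℝ ↦ |x| ^ a * (1 - |x|) ^ b) volume (-1) 1 := by
  have h : IntervalIntegrable (fun x : ℝ ↦ |x| ^ a * (1 - |x|) ^ b) volume 0 1 := by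
    refine (intervalIntegrable_rpow_mul_one_sub_rpow ha hb).congr (fun x hx ↦ ?_)
    rw [uIoc_of_le zero_le_one] at hx
    simp only [abs_of_pos hx.1]
  refine IntervalIntegrable.trans (b := 0) ?_ h
  rw [IntervalIntegrable.iff_comp_neg]
  simpa using h.symm

lemma abs_cos_sub_cos_le_two_mul_rpow {t ξ ρ δ : ℝ} (ht : t ∈ Icc (0 : ℝ) 1) (hξ : |ξ| < ρ)
    (hδ₀ : 0 < δ) (hδ₁ : δ ≤ 1) :
    |Real.cos (t * ξ) - Real.cos (t * ρ)| ≤ 2 * (ρ - |ξ|) ^ δ := by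
  have hs : 0 < ρ - |ξ| := sub_pos.2 hξ
  rcases le_total 1 (ρ - |ξ|) with h | h
  · have h1 : 1 ≤ (ρ - |ξ|) ^ δ := Real.one_le_rpow h hδ₀.le
    rw [abs_le]
    constructor <;>
      linarith [Real.cos_le_one (t * ξ), Real.cos_le_one (t * ρ), Real.neg_one_le_cos (t * ξ),
        Real.neg_one_le_cos (t * ρ)]
  · have hcos : Real.cos (t * ξ) = Real.cos (t * |ξ|) := by
      rw [← Real.cos_abs (t * ξ), abs_mul, abs_of_nonneg ht.1]
    have h1 : ρ - |ξ| ≤ (ρ - |ξ|) ^ δ := by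
      simpa using Real.rpow_le_rpow_of_exponent_ge hs h hδ₁
    calc |Real.cos (t * ξ) - Real.cos (t * ρ)| ≤ |t * |ξ| - t * ρ| := by
          rw [hcos]; exact Real.abs_cos_sub_cos_le _ _
      _ = t * (ρ - |ξ|) := by
          rw [← mul_sub, abs_mul, abs_of_nonneg ht.1, abs_sub_comm, abs_of_pos hs]
      _ ≤ 1 * (ρ - |ξ|) := by gcongr; exact ht.2
      _ ≤ 2 * (ρ - |ξ|) ^ δ := by linarith

lemma abs_Lam2_le {t ξ ρ δ : ℝ} (hρ : 1 < ρ) (ht : t ∈ Icc (0 : ℝ) 1) (hξ : |ξ| < ρ)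
    (hδ₀ : 0 < δ) (hδ₁ : δ ≤ 1) :
    |Lam2 t ξ ρ| ≤ 10 / ρ ^ 3 * (ρ - |ξ|) ^ (δ - 1) := by
  have hρ₀ : 0 < ρ := by linarith
  have hs : 0 < ρ - |ξ| := sub_pos.2 hξ
  have hpow : 1 / ρ ≤ (ρ - |ξ|) ^ (δ - 1) :=
    calc 1 / ρ = ρ ^ (-1 : ℝ) := by rw [Real.rpow_neg_one, one_div]
      _ ≤ ρ ^ (δ - 1) := Real.rpow_le_rpow_of_exponent_le hρ.le (by linarith)
      _ ≤ (ρ - |ξ|) ^ (δ - 1) :=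
        Real.rpow_le_rpow_of_nonpos hs (by linarith [abs_nonneg ξ]) (by linarith)
  have hfst : |if ξ ≤ ρ / 2 then (1 - Real.cos (t * (ξ - ρ))) / (ρ ^ 2 * (ξ - ρ) ^ 2) else 0| ≤
      8 / ρ ^ 3 * (ρ - |ξ|) ^ (δ - 1) := by
    split_ifs with h
    · have hsq : ρ ^ 2 / 4 ≤ (ξ - ρ) ^ 2 := by nlinarith
      have hnum : 0 ≤ 1 - Real.cos (t * (ξ - ρ)) := by linarith [Real.cos_le_one (t * (ξ - ρ))]
      rw [abs_of_nonneg (by positivity)]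
      calc (1 - Real.cos (t * (ξ - ρ))) / (ρ ^ 2 * (ξ - ρ) ^ 2) ≤ 2 / (ρ ^ 2 * (ρ ^ 2 / 4)) := by
            gcongr
            linarith [Real.neg_one_le_cos (t * (ξ - ρ))]
        _ = 8 / ρ ^ 3 * (1 / ρ) := by field_simp; norm_num
        _ ≤ _ := by gcongr
    · rw [abs_zero]; positivity
  have hsnd : |Real.cos (t * ρ) * (Real.cos (t * ξ) - Real.cos (t * ρ)) /
      (ρ ^ 2 * (ξ - ρ) * (ξ + ρ))| ≤ 2 / ρ ^ 3 * (ρ - |ξ|) ^ (δ - 1) := by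
    have hden : |ρ ^ 2 * (ξ - ρ) * (ξ + ρ)| = ρ ^ 2 * (ρ - |ξ|) * (ρ + |ξ|) := by
      have h2 : ρ ^ 2 * (ξ - ρ) * (ξ + ρ) = -(ρ ^ 2 * (ρ - |ξ|) * (ρ + |ξ|)) := by
        linear_combination (-ρ ^ 2) * sq_abs ξ
      rw [h2, abs_neg, abs_of_nonneg (by positivity)]
    have hsplit : (ρ - |ξ|) ^ δ = (ρ - |ξ|) * (ρ - |ξ|) ^ (δ - 1) := by
      rw [Real.rpow_sub_one hs.ne']; field_simp
    rw [abs_div, hden, abs_mul]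
    calc |Real.cos (t * ρ)| * |Real.cos (t * ξ) - Real.cos (t * ρ)| /
          (ρ ^ 2 * (ρ - |ξ|) * (ρ + |ξ|))
        ≤ 1 * (2 * (ρ - |ξ|) ^ δ) / (ρ ^ 2 * (ρ - |ξ|) * ρ) := by
          gcongr
          · exact Real.abs_cos_le_one _
          · exact abs_cos_sub_cos_le_two_mul_rpow ht hξ hδ₀ hδ₁
          · linarith [abs_nonneg ξ]
      _ = 2 / ρ ^ 3 * (ρ - |ξ|) ^ (δ - 1) := by
          rw [hsplit]; field_simp
  calc |Lam2 t ξ ρ| ≤ _ := abs_add_le _ _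
    _ ≤ 8 / ρ ^ 3 * (ρ - |ξ|) ^ (δ - 1) + 2 / ρ ^ 3 * (ρ - |ξ|) ^ (δ - 1) := add_le_add hfst hsnd
    _ = 10 / ρ ^ 3 * (ρ - |ξ|) ^ (δ - 1) := by ring

/-- for `H₀ ∈ (0,1)` and `ε > 0` there is `C > 0` such that for all `ρ > 1`
and `t ∈ [0,1]`, `|∫_{−ρ}^{ρ} Λ²_t(ξ,ρ) |ξ|^{1−2H₀} dξ| ≤ C ρ^{−(2H₀+2−ε)}`. -/
theorem stmt_11 (H₀ : ℝ) (h₀ : H₀ ∈ Ioo (0:ℝ) 1) (ε : ℝ) (hε : 0 < ε) :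
    ∃ C : ℝ, 0 < C ∧ ∀ ρ : ℝ, 1 < ρ → ∀ t ∈ Icc (0:ℝ) 1,
      |∫ ξ in Ioo (-ρ) ρ, Lam2 t ξ ρ * |ξ| ^ (1 - 2*H₀)| ≤
        C * ρ ^ (-(2*H₀ + 2 - ε)) := by
  obtain ⟨hH₀, hH₁⟩ := h₀
  obtain ⟨δ, hδ₀, hδ₁, hδε⟩ : ∃ δ : ℝ, 0 < δ ∧ δ ≤ 1 ∧ δ ≤ ε :=
    ⟨min 1 ε, lt_min one_pos hε, min_le_left _ _, min_le_right _ _⟩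
  set k : ℝ → ℝ := fun x ↦ |x| ^ (1 - 2 * H₀) * (1 - |x|) ^ (δ - 1) with hk
  have hkint : IntervalIntegrable k volume (-1) 1 :=
    intervalIntegrable_abs_rpow_mul_one_sub_abs_rpow (by linarith) (by linarith)
  have hI : 0 ≤ ∫ x in (-1)..1, k x := by
    refine intervalIntegral.integral_nonneg (by norm_num) (fun x hx ↦ ?_)
    have : 0 ≤ 1 - |x| := sub_nonneg.2 (abs_le.2 hx)
    positivity
  refine ⟨10 * (∫ x in (-1)..1, k x) + 1, by positivity, fun ρ hρ t ht ↦ ?_⟩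
  have hρ₀ : 0 < ρ := by linarith
  set c : ℝ := 10 / ρ ^ 3 * (ρ ^ (1 - 2 * H₀) * ρ ^ (δ - 1)) with hc
  have hscaled : IntervalIntegrable (fun ξ ↦ c * k (ξ / ρ)) volume (-ρ) ρ := by
    have h := (hkint.comp_mul_right (c := ρ⁻¹)).const_mul c
    simpa [div_eq_mul_inv] using h
  have hbound : ∀ ξ ∈ Ioo (-ρ) ρ, ‖Lam2 t ξ ρ * |ξ| ^ (1 - 2 * H₀)‖ ≤ c * k (ξ / ρ) := by
    intro ξ hξ
    have hξ' : |ξ| < ρ := abs_lt.2 hξ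
    have hs : 0 < ρ - |ξ| := sub_pos.2 hξ'
    have hsub : 1 - |ξ| / ρ = (ρ - |ξ|) / ρ := by field_simp
    have hck : c * k (ξ / ρ) = 10 / ρ ^ 3 * (ρ - |ξ|) ^ (δ - 1) * |ξ| ^ (1 - 2 * H₀) := by
      simp only [hk, hc]
      rw [abs_div, abs_of_pos hρ₀, hsub, Real.div_rpow (abs_nonneg ξ) hρ₀.le,
        Real.div_rpow hs.le hρ₀.le]
      have h1 := (Real.rpow_pos_of_pos hρ₀ (1 - 2 * H₀)).ne'
      have h2 := (Real.rpow_pos_of_pos hρ₀ (δ - 1)).ne'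
      field_simp
    rw [hck, norm_mul, Real.norm_eq_abs, Real.norm_of_nonneg (by positivity)]
    gcongr
    exact abs_Lam2_le hρ ht hξ' hδ₀ hδ₁
  have hcρ : c * ρ = 10 * ρ ^ (δ - 2 * H₀ - 2) := by
    have h3 : ρ ^ (δ - 2 * H₀ - 2) = ρ ^ (1 - 2 * H₀) * ρ ^ (δ - 1) / ρ ^ 2 := by
      rw [← Real.rpow_add hρ₀, ← Real.rpow_natCast ρ 2, ← Real.rpow_sub hρ₀]
      congr 1; push_cast; ring
    rw [h3, hc]; field_simp
  calc |∫ ξ in Ioo (-ρ) ρ, Lam2 t ξ ρ * |ξ| ^ (1 - 2*H₀)|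
      ≤ ∫ ξ in Ioo (-ρ) ρ, c * k (ξ / ρ) :=
        norm_integral_le_of_norm_le
          ((intervalIntegrable_iff_integrableOn_Ioo_of_le (by linarith)).1 hscaled)
          ((ae_restrict_mem measurableSet_Ioo).mono hbound)
    _ = c * ρ * ∫ x in (-1)..1, k x := by
        rw [← integral_Ioc_eq_integral_Ioo, ← intervalIntegral.integral_of_le (by linarith),
          intervalIntegral.integral_const_mul, intervalIntegral.integral_comp_div k hρ₀.ne',
          neg_div, div_self hρ₀.ne', smul_eq_mul]; ring
    _ = 10 * (∫ x in (-1)..1, k x) * ρ ^ (δ - 2 * H₀ - 2) := by rw [hcρ]; ring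
    _ ≤ (10 * (∫ x in (-1)..1, k x) + 1) * ρ ^ (-(2*H₀ + 2 - ε)) := by
        gcongr
        · linarith
        · exact hρ.le
        · linarith
end

section
/- Let α ∈ (0, 1/2). Then there exists a constant C > 0, depending only on α, such that for every a ≥ 0, ∫_{a/2}^{3a/2} (ρ/(1+ρ²)) · (1 + (a−ρ)²)^{−α} dρ ≤ C / (1 + a^{2α}). -/
open MeasureTheory Set

/-- Up to the factor `1 - 2α`, the derivative of `x ↦ (x - a) (1 + (a - x)²)^{-α}` dominates
`(1 + (a - x)²)^{-α}`. -/
lemma rpow_le_deriv_mul_rpow {α : ℝ} (hα : 0 ≤ α) (a x : ℝ) :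
    (1 - 2 * α) * (1 + (a - x) ^ 2) ^ (-α) ≤
      (1 + (a - x) ^ 2) ^ (-α) - 2 * α * (x - a) ^ 2 * (1 + (a - x) ^ 2) ^ (-α - 1) := by
  have hp : 0 < 1 + (a - x) ^ 2 := by positivity
  have hq : 0 ≤ (1 + (a - x) ^ 2) ^ (-α - 1) := by positivity
  have h : (1 + (a - x) ^ 2) ^ (-α) = (1 + (a - x) ^ 2) ^ (-α - 1) * (1 + (a - x) ^ 2) := by
    rw [← Real.rpow_add_one hp.ne']
    ring_nf
  rw [h]
  nlinarith [mul_nonneg hα hq]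

lemma hasDerivAt_sub_mul_rpow (α a x : ℝ) :
    HasDerivAt (fun y : ℝ => (y - a) * (1 + (a - y) ^ 2) ^ (-α))
      ((1 + (a - x) ^ 2) ^ (-α) - 2 * α * (x - a) ^ 2 * (1 + (a - x) ^ 2) ^ (-α - 1)) x := by
  have hp : 0 < 1 + (a - x) ^ 2 := by positivity
  have h₁ : HasDerivAt (fun y : ℝ => 1 + (a - y) ^ 2) (2 * (x - a)) x := by
    refine ((((hasDerivAt_id x).const_sub a).pow 2).const_add 1).congr_deriv ?_
    simp
    ring
  refine (((hasDerivAt_id x).sub_const a).mul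
    (h₁.rpow_const (p := -α) (Or.inl hp.ne'))).congr_deriv ?_
  simp only [id]
  ring

/-- `(1 + a²/4)^{-α}` is controlled by `(1 + a^{2α})⁻¹` for `0 ≤ α ≤ 1/2`. -/
lemma rpow_neg_le_div_one_add_rpow {α a : ℝ} (hα0 : 0 ≤ α) (hα1 : α ≤ 1 / 2) (ha : 0 ≤ a) :
    (1 + (a / 2) ^ 2) ^ (-α) ≤ 4 / (1 + a ^ (2 * α)) := by
  have hp : 0 < 1 + (a / 2) ^ 2 := by positivity
  have h₁ : 1 ≤ (1 + (a / 2) ^ 2) ^ α := Real.one_le_rpow (by nlinarith [sq_nonneg (a / 2)]) hα0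
  have h₂ : a ^ (2 * α) ≤ 2 * (1 + (a / 2) ^ 2) ^ α := by
    have h4 : (4 : ℝ) ^ α ≤ 2 := by
      calc (4 : ℝ) ^ α ≤ 4 ^ (1 / 2 : ℝ) := Real.rpow_le_rpow_of_exponent_le (by norm_num) hα1
        _ = 2 := by
          rw [← Real.sqrt_eq_rpow, show (4 : ℝ) = 2 ^ 2 by norm_num]
          exact Real.sqrt_sq (by norm_num)
    calc a ^ (2 * α) = (a ^ 2) ^ α := by
          rw [Real.rpow_mul ha, Real.rpow_two]
      _ ≤ (4 * (1 + (a / 2) ^ 2)) ^ α :=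
          Real.rpow_le_rpow (by positivity) (by nlinarith) hα0
      _ = 4 ^ α * (1 + (a / 2) ^ 2) ^ α := Real.mul_rpow (by norm_num) hp.le
      _ ≤ _ := by gcongr
  rw [Real.rpow_neg hp.le, ← one_div, div_le_div_iff₀ (by positivity) (by positivity)]
  linarith

/-- For `0 < α < 1/2` there is a constant `C > 0` such that for every `a ≥ 0`,
`∫_{a/2}^{3a/2} (ρ/(1+ρ²)) (1+(a−ρ)²)^{−α} dρ ≤ C/(1+a^{2α})`. -/
theorem stmt_14 (α : ℝ) (hα0 : 0 < α) (hα1 : α < 1/2) :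
    ∃ C : ℝ, 0 < C ∧ ∀ a : ℝ, 0 ≤ a →
      (∫⁻ ρ in Icc (a/2) (3*a/2),
          ENNReal.ofReal (ρ / (1 + ρ^2) * (1 + (a - ρ)^2) ^ (-α))) ≤
        ENNReal.ofReal (C / (1 + a ^ (2*α))) := by
  have hβ : 0 < 1 - 2 * α := by linarith
  refine ⟨8 / (1 - 2 * α), by positivity, fun a ha => ?_⟩
  rcases ha.eq_or_lt with rfl | ha
  · simp
  set k : ℝ := 2 / a / (1 - 2 * α) with hk
  have hk0 : 0 < k := by positivity
  let g : ℝ → ℝ := fun x =>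
    (1 + (a - x) ^ 2) ^ (-α) - 2 * α * (x - a) ^ 2 * (1 + (a - x) ^ 2) ^ (-α - 1)
  have hgc : Continuous g := by
    have hc (p : ℝ) : Continuous fun x : ℝ => (1 + (a - x) ^ 2) ^ p :=
      Continuous.rpow_const (by fun_prop) fun x => Or.inl (by positivity)
    exact (hc _).sub ((by fun_prop : Continuous fun x : ℝ => 2 * α * (x - a) ^ 2).mul (hc _))
  have hle (x : ℝ) : (1 - 2 * α) * (1 + (a - x) ^ 2) ^ (-α) ≤ g x :=
    rpow_le_deriv_mul_rpow hα0.le a x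
  have hg0 (x : ℝ) : 0 ≤ g x := le_trans (by positivity) (hle x)
  have hI : ∫ x in Icc (a / 2) (3 * a / 2), k * g x =
      k * (a * (1 + (a / 2) ^ 2) ^ (-α)) := by
    rw [integral_Icc_eq_integral_Ioc, ← intervalIntegral.integral_of_le (by linarith),
      intervalIntegral.integral_const_mul,
      intervalIntegral.integral_eq_sub_of_hasDerivAt
        (fun x _ => hasDerivAt_sub_mul_rpow α a x) (hgc.intervalIntegrable _ _),
      show (a - 3 * a / 2) ^ 2 = (a / 2) ^ 2 by ring, show (a - a / 2) ^ 2 = (a / 2) ^ 2 by ring]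
    ring
  calc _ ≤ ∫⁻ x in Icc (a / 2) (3 * a / 2), ENNReal.ofReal (k * g x) := by
        refine setLIntegral_mono' measurableSet_Icc fun x hx => ENNReal.ofReal_le_ofReal ?_
        have hx0 : 0 < x := by linarith [hx.1]
        have h₁ : x / (1 + x ^ 2) ≤ 2 / a := by
          rw [div_le_div_iff₀ (by positivity) ha]
          nlinarith [hx.1]
        calc x / (1 + x ^ 2) * (1 + (a - x) ^ 2) ^ (-α)
            ≤ 2 / a * (1 + (a - x) ^ 2) ^ (-α) := by gcongr
          _ = k * ((1 - 2 * α) * (1 + (a - x) ^ 2) ^ (-α)) := by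
            rw [hk]
            field_simp
          _ ≤ k * g x := by gcongr; exact hle x
    _ = ENNReal.ofReal (k * (a * (1 + (a / 2) ^ 2) ^ (-α))) := by
        rw [← hI, ofReal_integral_eq_lintegral_ofReal]
        · exact (continuous_const.mul hgc).continuousOn.integrableOn_Icc
        · exact Filter.Eventually.of_forall fun x => mul_nonneg hk0.le (hg0 x)
    _ ≤ _ := by
        refine ENNReal.ofReal_le_ofReal ?_
        calc k * (a * (1 + (a / 2) ^ 2) ^ (-α))
            = 2 / (1 - 2 * α) * (1 + (a / 2) ^ 2) ^ (-α) := by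
              rw [hk]
              field_simp
          _ ≤ 2 / (1 - 2 * α) * (4 / (1 + a ^ (2 * α))) := by
              gcongr
              exact rpow_neg_le_div_one_add_rpow hα0.le hα1.le ha.le
          _ = _ := by
              ring
end
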